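/- arXiv:1311.2232 — 2 statements merged into one kernel-verified Lean document; each statement's English description precedes it below -/
import Mathlib

section
/- Let Γ be a finite simplicial graph defining the right-angled Artin group A = A(Γ). If Γ contains no SIL, then the pure symmetric automorphism group PΣ(A) is isomorphic to a right-angled Artin group, i.e., there exists a finite simplicial graph Δ with PΣ(A) ≅ A(Δ). -/
open SimpleGraph

/-- The star of a vertex: the vertex together with its neighbours. -/
def Gstar {V : Type} (Γ : SimpleGraph V) (a : V) : Set V := insert a (Γ.neighborSet a)

/-- The set of vertices whose star is the whole vertex set. -/
def Zset {V : Type} (Γ : SimpleGraph V) : Set V := {v | Gstar Γ v = Set.univ}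

/-- `K` is (the vertex set of) a connected component of the full subgraph of `Γ`
induced on the vertex set `S`. -/
def IsCompOf {V : Type} (Γ : SimpleGraph V) (S K : Set V) : Prop :=
  ∃ c : (Γ.induce S).ConnectedComponent, K = Subtype.val '' c.supp

/-- The defining relators of the right-angled Artin group of `Γ`. -/
def raagRels {V : Type} (Γ : SimpleGraph V) : Set (FreeGroup V) :=
  {r | ∃ a b : V, Γ.Adj a b ∧
    r = FreeGroup.of a * FreeGroup.of b * (FreeGroup.of a)⁻¹ * (FreeGroup.of b)⁻¹}

/-- The right-angled Artin group `A(Γ)`. -/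
abbrev RAAG {V : Type} (Γ : SimpleGraph V) : Type := PresentedGroup (raagRels Γ)

/-- The generator of `A(Γ)` corresponding to a vertex `v`. -/
def raagGen {V : Type} (Γ : SimpleGraph V) (v : V) : RAAG Γ := PresentedGroup.of v

/-- The pure symmetric automorphism group: automorphisms sending each standard
generator to a conjugate of itself. -/
def PSA {V : Type} (Γ : SimpleGraph V) : Subgroup (MulAut (RAAG Γ)) where
  carrier := {φ | ∀ v : V, IsConj (raagGen Γ v) (φ (raagGen Γ v))}
  one_mem' := fun v => IsConj.refl _
  mul_mem' := by
    intro φ ψ hφ hψ v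
    have h2 : IsConj (φ (raagGen Γ v)) (φ (ψ (raagGen Γ v))) :=
      φ.toMonoidHom.map_isConj (hψ v)
    simpa [MulAut.mul_apply] using (hφ v).trans h2
  inv_mem' := by
    intro φ hφ v
    have h := (φ⁻¹ : MulAut (RAAG _)).toMonoidHom.map_isConj (hφ v)
    simp only [MulEquiv.toMonoidHom_eq_coe, MonoidHom.coe_coe, MulAut.inv_def,
      MulEquiv.symm_apply_apply] at h
    exact h.symm

/-- `φ` is the partial conjugation `π_{a,K}`. -/
def IsPartialConj {V : Type} (Γ : SimpleGraph V) (a : V) (K : Set V)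
    (φ : MulAut (RAAG Γ)) : Prop :=
  IsCompOf Γ (Gstar Γ a)ᶜ K ∧
  (∀ v ∈ K, φ (raagGen Γ v) = (raagGen Γ a)⁻¹ * raagGen Γ v * raagGen Γ a) ∧
  (∀ v ∉ K, φ (raagGen Γ v) = raagGen Γ v)

/-- Combinatorial data (acting letter, domain) of the partial conjugations. -/
def PCSet {V : Type} (Γ : SimpleGraph V) : Set (V × Set V) :=
  {p | IsCompOf Γ (Gstar Γ p.1)ᶜ p.2}

/-- A non-trivial admissible partition (for p-sets). -/
def IsAdmissiblePartition {V : Type} (Q₁ Q₂ : Set (V × Set V)) : Prop :=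
  Disjoint Q₁ Q₂ ∧ Q₁.Nonempty ∧ Q₂.Nonempty ∧
    ∀ p ∈ Q₁, ∀ q ∈ Q₂, p.1 ∈ q.2 ∧ q.1 ∈ p.2

/-- A p-set of partial conjugations. -/
def IsPSet {V : Type} (Γ : SimpleGraph V) (Q : Set (V × Set V)) : Prop :=
  Q ⊆ PCSet Γ ∧
  (∀ a : V, {p ∈ Q | p.1 = a}.Subsingleton) ∧
  ∃ Q₁ Q₂ : Set (V × Set V), Q₁ ∪ Q₂ = Q ∧ IsAdmissiblePartition Q₁ Q₂

/-- A non-trivial admissible partition (for δ-p-sets). -/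
def IsDeltaAdmissiblePartition {V : Type} (Q₁ Q₂ : Set (V × Set V)) : Prop :=
  Disjoint Q₁ Q₂ ∧ Q₁.Nonempty ∧ Q₂.Nonempty ∧
    ∀ p ∈ Q₁, ∀ q ∈ Q₂, p.1 ∈ q.2 ∨ q.1 ∈ p.2 ∨ p.2 = q.2

/-- A δ-p-set of partial conjugations. -/
def IsDeltaPSet {V : Type} (Γ : SimpleGraph V) (Q : Set (V × Set V)) : Prop :=
  Q ⊆ PCSet Γ ∧
  (∀ a : V, a ∉ Zset Γ →
    ({p ∈ Q | p.1 = a}.ncard = 0 ∨ {p ∈ Q | p.1 = a}.ncard = 2)) ∧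
  ∃ Q₁ Q₂ : Set (V × Set V), Q₁ ∪ Q₂ = Q ∧ IsDeltaAdmissiblePartition Q₁ Q₂

/-- `Γ` has a separating intersection of links. -/
def HasSIL {V : Type} (Γ : SimpleGraph V) : Prop :=
  ∃ a b : V, a ≠ b ∧ ¬Γ.Adj a b ∧
    ∃ M : Set V, IsCompOf Γ (Γ.neighborSet a ∩ Γ.neighborSet b)ᶜ M ∧ a ∉ M ∧ b ∉ M

/-- The full subgraph spanned by `U` is dominating. -/
def Dominating {V : Type} (Γ : SimpleGraph V) (U : Set V) : Prop :=
  ∀ v : V, v ∈ U ∨ ∃ u ∈ U, Γ.Adj v u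

/-- The full subgraph spanned by `U` is disconnected or non-dominating. -/
def Missing {V : Type} (Γ : SimpleGraph V) (U : Set V) : Prop :=
  ¬(Γ.induce U).Connected ∨ ¬Dominating Γ U

theorem mk_mem_zpowers_of_forall {α : Type*} (e : α) (w : List (α × Bool)) (hw : ∀ q ∈ w, q.1 = e) :
    FreeGroup.mk w ∈ Subgroup.zpowers (FreeGroup.of e) := by
  induction w with
  | nil => exact one_mem _
  | cons p w ih =>
    have h1 : FreeGroup.mk (p :: w) = FreeGroup.mk [p] * FreeGroup.mk w := by simp
    rw [h1]
    refine mul_mem ?_ (ih fun q hq => hw q (List.mem_cons_of_mem _ hq))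
    obtain ⟨a, b⟩ := p
    obtain rfl : a = e := hw (a, b) (by simp)
    cases b
    · have : FreeGroup.mk [(a, false)] = (FreeGroup.of a)⁻¹ := by
        simp [FreeGroup.of, FreeGroup.invRev]
      rw [this]
      exact inv_mem (Subgroup.mem_zpowers _)
    · exact Subgroup.mem_zpowers _

theorem isReduced_map_equiv {α β : Type*} (σ : α ≃ β) (w : List (α × Bool))
    (hw : FreeGroup.IsReduced w) :
    FreeGroup.IsReduced (w.map fun p => (σ p.1, p.2)) := by
  unfold FreeGroup.IsReduced at hw ⊢
  rw [List.isChain_map]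
  simpa using hw

section LeadingExponent

variable {α : Type*} [DecidableEq α]

/-- The exponent sum of the longest initial segment of a word made of the letter `e`. -/
def wordLead (e : α) (w : List (α × Bool)) : ℤ :=
  ((w.takeWhile fun p => decide (p.1 = e)).map fun p => if p.2 then (1 : ℤ) else -1).sum

/-- The exponent of the leading `e`-syllable of an element of a free group. -/
def freeLead (e : α) (ξ : FreeGroup α) : ℤ := wordLead e ξ.toWord

theorem wordLead_cons_self (e : α) (b : Bool) (w : List (α × Bool)) :
    wordLead e ((e, b) :: w) = (if b then 1 else -1) + wordLead e w := by
  simp [wordLead]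

theorem wordLead_append_singleton (e : α) (w : List (α × Bool)) (p : α × Bool) :
    wordLead e (w ++ [p]) = wordLead e w ∨ (p.1 = e ∧ ∀ q ∈ w, q.1 = e) := by
  by_cases hw : ∀ q ∈ w, q.1 = e
  · by_cases hp : p.1 = e
    · exact Or.inr ⟨hp, hw⟩
    · left
      unfold wordLead
      rw [List.takeWhile_append_of_pos (by simpa using hw)]
      simp [hp, List.takeWhile_eq_self_iff.2 (by simpa using hw :
        ∀ x ∈ w, (fun p : α × Bool => decide (p.1 = e)) x = true)]
  · left
    unfold wordLead
    rw [List.takeWhile_append, if_neg]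
    intro h
    have h1 := List.takeWhile_eq_self_iff.1 ((List.takeWhile_prefix _).eq_of_length h)
    exact hw fun q hq => by simpa using h1 q hq

theorem toWord_mul_letter (ξ : FreeGroup α) (p : α × Bool) :
    (ξ * FreeGroup.mk [p]).toWord = ξ.toWord ++ [p] ∨
      ξ.toWord = (ξ * FreeGroup.mk [p]).toWord ++ [(p.1, !p.2)] := by
  have h1 : (ξ * FreeGroup.mk [p]).toWord = FreeGroup.reduce (ξ.toWord ++ [p]) := by
    rw [FreeGroup.toWord_mul, FreeGroup.toWord_mk, FreeGroup.reduce_singleton]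
  have hred : FreeGroup.IsReduced ξ.toWord := FreeGroup.isReduced_toWord
  rcases List.eq_nil_or_concat ξ.toWord with h | ⟨w, q, h⟩
  · left
    rw [h1, h]
    rfl
  · rw [List.concat_eq_append] at h
    by_cases hq : q = (p.1, !p.2)
    · right
      have h2 : ξ * FreeGroup.mk [p] = FreeGroup.mk w := by
        conv_lhs => rw [← FreeGroup.mk_toWord (x := ξ), h, hq]
        rw [FreeGroup.mul_mk]
        apply Quot.sound
        have := @FreeGroup.Red.Step.not α w [] p.1 (!p.2)
        simpa using this
      have hw : FreeGroup.IsReduced w := by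
        rw [h] at hred
        exact List.IsChain.left_of_append hred
      rw [h2, FreeGroup.toWord_mk, hw.reduce_eq, h, hq]
    · left
      rw [h1]
      apply FreeGroup.IsReduced.reduce_eq
      rw [h] at hred ⊢
      unfold FreeGroup.IsReduced at hred ⊢
      rw [List.isChain_append]
      refine ⟨hred, by simp, ?_⟩
      intro x hx y hy hxy
      simp only [List.getLast?_append, List.getLast?_singleton, Option.mem_def, Option.some_or,
        Option.some.injEq, List.head?_cons] at hx hy
      subst hx hy
      obtain ⟨a, b⟩ := q
      obtain ⟨c, d⟩ := p
      simp only [Prod.mk.injEq, not_and] at hq hxy ⊢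
      have := hq hxy
      cases b <;> cases d <;> simp_all

theorem freeLead_mul_letter (e : α) (ξ : FreeGroup α) (p : α × Bool) :
    freeLead e (ξ * FreeGroup.mk [p]) = freeLead e ξ ∨
      (p.1 = e ∧ ξ ∈ Subgroup.zpowers (FreeGroup.of e)) := by
  unfold freeLead
  rcases toWord_mul_letter ξ p with h | h
  · rw [h]
    refine (wordLead_append_singleton e _ p).imp_right fun ⟨h1, h2⟩ => ⟨h1, ?_⟩
    rw [← FreeGroup.mk_toWord (x := ξ)]
    exact mk_mem_zpowers_of_forall e _ h2
  · rw [h]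
    refine (wordLead_append_singleton e _ _).imp Eq.symm fun ⟨h1, h2⟩ => ⟨h1, ?_⟩
    rw [← FreeGroup.mk_toWord (x := ξ), h]
    refine mk_mem_zpowers_of_forall e _ fun q hq => ?_
    rcases List.mem_append.1 hq with hq | hq
    · exact h2 q hq
    · rw [List.mem_singleton.1 hq]
      exact h1

theorem freeLead_mul_of (e β : α) (ξ : FreeGroup α)
    (h : freeLead e (ξ * FreeGroup.of β) ≠ freeLead e ξ) :
    β = e ∧ ξ ∈ Subgroup.zpowers (FreeGroup.of e) :=
  (freeLead_mul_letter e ξ (β, true)).resolve_left h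

theorem freeLead_of_mul (e : α) (ξ : FreeGroup α) :
    freeLead e (FreeGroup.of e * ξ) = freeLead e ξ + 1 := by
  unfold freeLead
  have h : (FreeGroup.of e * ξ).toWord = FreeGroup.reduce ((e, true) :: ξ.toWord) := by
    rw [FreeGroup.toWord_mul, FreeGroup.toWord_of]
    rfl
  rw [h, FreeGroup.reduce.cons, FreeGroup.reduce_toWord]
  rcases ξ.toWord with _ | ⟨⟨a, b⟩, w⟩
  · simp [wordLead]
  · by_cases hab : e = a ∧ b = false
    · obtain ⟨rfl, rfl⟩ := hab
      simp [wordLead_cons_self]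
    · have : ¬ (e = a ∧ true = !b) := by
        cases b <;> simp_all
      simp only [this, if_false, wordLead_cons_self e true]
      simp [add_comm]

theorem freeLead_one (e : α) : freeLead e 1 = 0 := by
  simp [freeLead, wordLead]

theorem freeLead_congr (e : α) (σ : α ≃ α) (he : σ e = e) (ξ : FreeGroup α) :
    freeLead e (FreeGroup.freeGroupCongr σ ξ) = freeLead e ξ := by
  have h : (FreeGroup.freeGroupCongr σ ξ).toWord = ξ.toWord.map fun p => (σ p.1, p.2) := by
    have h1 : FreeGroup.freeGroupCongr σ ξ =
        FreeGroup.mk (ξ.toWord.map fun p => (σ p.1, p.2)) := by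
      conv_lhs => rw [← FreeGroup.mk_toWord (x := ξ)]
      rfl
    rw [h1, FreeGroup.toWord_mk]
    exact (isReduced_map_equiv σ _ FreeGroup.isReduced_toWord).reduce_eq
  unfold freeLead wordLead
  rw [h, List.takeWhile_map, List.map_map]
  have hσ : ∀ a, σ a = e ↔ a = e := fun a => by
    rw [← he, σ.apply_eq_iff_eq, he]
  simp [Function.comp_def, hσ]

end LeadingExponent

section Basics

variable {V : Type} {Γ : SimpleGraph V}

theorem raagGen_commute {a b : V} (h : Γ.Adj a b) : Commute (raagGen Γ a) (raagGen Γ b) := by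
  have h1 : PresentedGroup.mk (raagRels Γ)
      (FreeGroup.of a * FreeGroup.of b * (FreeGroup.of a)⁻¹ * (FreeGroup.of b)⁻¹) = 1 :=
    PresentedGroup.one_of_mem ⟨a, b, h, rfl⟩
  simp only [map_mul, map_inv] at h1
  rw [mul_inv_eq_one, mul_inv_eq_iff_eq_mul] at h1
  exact h1

/-- The homomorphism out of a right-angled Artin group determined by images of the generators. -/
def raagLift {G : Type*} [Group G] (f : V → G) (hf : ∀ a b, Γ.Adj a b → Commute (f a) (f b)) :
    RAAG Γ →* G :=
  PresentedGroup.toGroup (f := f) (by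
    rintro r ⟨a, b, hab, rfl⟩
    simp only [map_mul, map_inv, FreeGroup.lift_apply_of]
    rw [mul_inv_eq_one, mul_inv_eq_iff_eq_mul]
    exact hf a b hab)

@[simp]
theorem raagLift_gen {G : Type*} [Group G] (f : V → G)
    (hf : ∀ a b, Γ.Adj a b → Commute (f a) (f b)) (v : V) :
    raagLift f hf (raagGen Γ v) = f v :=
  PresentedGroup.toGroup.of _

theorem raag_hom_ext {G : Type*} [Group G] {φ ψ : RAAG Γ →* G}
    (h : ∀ v, φ (raagGen Γ v) = ψ (raagGen Γ v)) : φ = ψ :=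
  PresentedGroup.ext h

theorem raag_aut_ext {φ ψ : MulAut (RAAG Γ)}
    (h : ∀ v, φ (raagGen Γ v) = ψ (raagGen Γ v)) : φ = ψ :=
  MulEquiv.toMonoidHom_injective (raag_hom_ext h)

theorem closure_range_raagGen : Subgroup.closure (Set.range (raagGen Γ)) = ⊤ :=
  PresentedGroup.closure_range_of _

variable (Γ)

/-- The subgroup generated by the link of a vertex. -/
def linkSubgroup (v : V) : Subgroup (RAAG Γ) :=
  Subgroup.closure (raagGen Γ '' Γ.neighborSet v)

/-- The subgroup generated by the star of a vertex. -/
def starSubgroup (v : V) : Subgroup (RAAG Γ) :=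
  Subgroup.closure (raagGen Γ '' Gstar Γ v)

variable {Γ}

theorem raagGen_mem_starSubgroup (v : V) : raagGen Γ v ∈ starSubgroup Γ v :=
  Subgroup.subset_closure ⟨v, Set.mem_insert _ _, rfl⟩

theorem linkSubgroup_le_starSubgroup (v : V) : linkSubgroup Γ v ≤ starSubgroup Γ v :=
  Subgroup.closure_mono (Set.image_mono (Set.subset_insert _ _))

theorem commute_of_mem_starSubgroup {v : V} {c : RAAG Γ} (hc : c ∈ starSubgroup Γ v) :
    Commute c (raagGen Γ v) := by
  have h : starSubgroup Γ v ≤ Subgroup.centralizer {raagGen Γ v} := by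
    refine (Subgroup.closure_le _).2 ?_
    rintro _ ⟨w, hw, rfl⟩
    rw [SetLike.mem_coe, Subgroup.mem_centralizer_singleton_iff]
    rcases hw with rfl | hw
    · rfl
    · exact (raagGen_commute hw).symm
  exact Subgroup.mem_centralizer_singleton_iff.1 (h hc)

end Basics

section Splitting

variable {V : Type} (Γ : SimpleGraph V) (v : V)

/-- The action of `A(Γ)` on the free group over the cosets of the link subgroup of `v`. -/
def linkCosetAction : RAAG Γ →* MulAut (FreeGroup (RAAG Γ ⧸ linkSubgroup Γ v)) where
  toFun g := FreeGroup.freeGroupCongr (MulAction.toPerm g)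
  map_one' := by
    refine MulEquiv.toMonoidHom_injective (FreeGroup.ext_hom _ _ fun x => ?_)
    simp
  map_mul' g h := by
    refine MulEquiv.toMonoidHom_injective (FreeGroup.ext_hom _ _ fun x => ?_)
    simp [mul_smul]

/-- The coset of the identity, as a letter. -/
def baseCoset : RAAG Γ ⧸ linkSubgroup Γ v := ((1 : RAAG Γ) : RAAG Γ ⧸ linkSubgroup Γ v)

variable {Γ v}

theorem linkCosetAction_of (g : RAAG Γ) (x : RAAG Γ ⧸ linkSubgroup Γ v) :
    linkCosetAction Γ v g (FreeGroup.of x) = FreeGroup.of (g • x) := by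
  simp [linkCosetAction]

theorem smul_baseCoset_iff (g : RAAG Γ) :
    g • baseCoset Γ v = baseCoset Γ v ↔ g ∈ linkSubgroup Γ v := by
  change ((g * 1 : RAAG Γ) : RAAG Γ ⧸ linkSubgroup Γ v) = ((1 : RAAG Γ) : _) ↔ _
  rw [mul_one, eq_comm, QuotientGroup.eq]
  simp

variable (Γ v)

open Classical in
/-- The splitting of `A(Γ)` as a semidirect product with a free group, on which `v` is a basis
element. -/
noncomputable def vertexSplit :
    RAAG Γ →* FreeGroup (RAAG Γ ⧸ linkSubgroup Γ v) ⋊[linkCosetAction Γ v] RAAG Γ :=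
  raagLift (fun w => if w = v then SemidirectProduct.inl (FreeGroup.of (baseCoset Γ v))
    else SemidirectProduct.inr (raagGen Γ w)) (by
    have key : ∀ w, Γ.Adj v w → Commute
        (SemidirectProduct.inl (FreeGroup.of (baseCoset Γ v)) :
          FreeGroup (RAAG Γ ⧸ linkSubgroup Γ v) ⋊[linkCosetAction Γ v] RAAG Γ)
        (SemidirectProduct.inr (raagGen Γ w)) := by
      intro w hw
      have hm : raagGen Γ w ∈ linkSubgroup Γ v := Subgroup.subset_closure ⟨w, hw, rfl⟩
      ext
      · simp [linkCosetAction_of, (smul_baseCoset_iff _).2 hm]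
      · simp
    intro a b hab
    by_cases ha : a = v
    · subst ha
      simpa [hab.ne'] using key b hab
    · by_cases hb : b = v
      · subst hb
        simpa [ha] using (key a hab.symm).symm
      · simpa [ha, hb] using (raagGen_commute hab).map SemidirectProduct.inr)

theorem vertexSplit_self :
    vertexSplit Γ v (raagGen Γ v) = SemidirectProduct.inl (FreeGroup.of (baseCoset Γ v)) := by
  simp [vertexSplit]

variable {Γ v}

theorem vertexSplit_of_ne {w : V} (h : w ≠ v) :
    vertexSplit Γ v (raagGen Γ w) = SemidirectProduct.inr (raagGen Γ w) := by
  simp [vertexSplit, h]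

theorem vertexSplit_of_mem_link {c : RAAG Γ} (hc : c ∈ linkSubgroup Γ v) :
    vertexSplit Γ v c = SemidirectProduct.inr c := by
  have h : linkSubgroup Γ v ≤
      MonoidHom.eqLocus (vertexSplit Γ v) (SemidirectProduct.inr) := by
    refine (Subgroup.closure_le _).2 ?_
    rintro _ ⟨w, hw, rfl⟩
    exact vertexSplit_of_ne (Γ.ne_of_adj hw).symm
  exact h hc

variable (Γ v)

/-- The retraction of the semidirect product that undoes `vertexSplit`. -/
def vertexMerge :
    FreeGroup (RAAG Γ ⧸ linkSubgroup Γ v) ⋊[linkCosetAction Γ v] RAAG Γ →* RAAG Γ :=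
  SemidirectProduct.lift
    (FreeGroup.lift fun x => Quotient.liftOn' x
      (fun b => b * raagGen Γ v * b⁻¹) (by
        intro b c hbc
        have h1 : b⁻¹ * c ∈ linkSubgroup Γ v := QuotientGroup.leftRel_apply.1 hbc
        have h2 := commute_of_mem_starSubgroup (linkSubgroup_le_starSubgroup v h1)
        have h3 := h2.eq
        change b * raagGen Γ v * b⁻¹ = c * raagGen Γ v * c⁻¹
        rw [mul_inv_eq_iff_eq_mul]
        calc b * raagGen Γ v = b * (raagGen Γ v * (b⁻¹ * c)) * c⁻¹ * b := by group
          _ = b * ((b⁻¹ * c) * raagGen Γ v) * c⁻¹ * b := by rw [h3]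
          _ = _ := by group))
    (MonoidHom.id _) (by
      intro g
      ext x
      induction x using QuotientGroup.induction_on with
      | H b =>
        simp only [MonoidHom.comp_apply, MulEquiv.coe_toMonoidHom, linkCosetAction_of,
          FreeGroup.lift_apply_of]
        change (g * b) * raagGen Γ v * (g * b)⁻¹ = g * (b * raagGen Γ v * b⁻¹) * g⁻¹
        group)

theorem vertexMerge_vertexSplit (x : RAAG Γ) : vertexMerge Γ v (vertexSplit Γ v x) = x := by
  have h : (vertexMerge Γ v).comp (vertexSplit Γ v) = MonoidHom.id _ := by
    refine raag_hom_ext fun w => ?_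
    rw [MonoidHom.comp_apply, MonoidHom.id_apply]
    by_cases hw : w = v
    · subst hw
      rw [vertexSplit_self, vertexMerge, SemidirectProduct.lift_inl, FreeGroup.lift_apply_of]
      change 1 * raagGen Γ w * 1⁻¹ = _
      simp
    · rw [vertexSplit_of_ne hw, vertexMerge, SemidirectProduct.lift_inr, MonoidHom.id_apply]
  exact DFunLike.congr_fun h x

open Classical in
/-- The exponent of the leading `v`-syllable of an element of `A(Γ)`. -/
noncomputable def lead (x : RAAG Γ) : ℤ := freeLead (baseCoset Γ v) (vertexSplit Γ v x).left

open Classical in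
theorem lead_one : lead Γ v 1 = 0 := by
  simp [lead, freeLead_one]

open Classical in
theorem lead_self_mul (x : RAAG Γ) : lead Γ v (raagGen Γ v * x) = lead Γ v x + 1 := by
  simp [lead, vertexSplit_self, freeLead_of_mul]

variable {Γ v}

open Classical in
theorem lead_link_mul {c : RAAG Γ} (hc : c ∈ linkSubgroup Γ v) (x : RAAG Γ) :
    lead Γ v (c * x) = lead Γ v x := by
  unfold lead
  rw [map_mul, vertexSplit_of_mem_link hc, SemidirectProduct.mul_left]
  simp only [SemidirectProduct.left_inr, SemidirectProduct.right_inr, one_mul]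
  exact freeLead_congr _ _ ((smul_baseCoset_iff c).2 hc) _

theorem lead_mul_of_ne {w : V} (h : w ≠ v) (x : RAAG Γ) :
    lead Γ v (x * raagGen Γ w) = lead Γ v x := by
  simp [lead, vertexSplit_of_ne h]

open Classical in
theorem mem_starSubgroup_of_lead_ne {x : RAAG Γ}
    (h : lead Γ v (x * raagGen Γ v) ≠ lead Γ v x) : x ∈ starSubgroup Γ v := by
  unfold lead at h
  rw [map_mul, vertexSplit_self, SemidirectProduct.mul_left, SemidirectProduct.left_inl,
    linkCosetAction_of] at h
  obtain ⟨h1, h2⟩ := freeLead_mul_of _ _ _ h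
  rw [smul_baseCoset_iff] at h1
  obtain ⟨n, hn⟩ := Subgroup.mem_zpowers_iff.1 h2
  rw [← vertexMerge_vertexSplit Γ v x,
    ← SemidirectProduct.inl_left_mul_inr_right (vertexSplit Γ v x), map_mul, ← hn,
    map_zpow, map_zpow, ← vertexSplit_self, vertexMerge_vertexSplit]
  refine mul_mem (zpow_mem (raagGen_mem_starSubgroup v) n) ?_
  rw [vertexMerge, SemidirectProduct.lift_inr]
  exact linkSubgroup_le_starSubgroup v h1

theorem mem_starSubgroup_iff_commute {x : RAAG Γ} :
    x ∈ starSubgroup Γ v ↔ Commute x (raagGen Γ v) := by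
  refine ⟨commute_of_mem_starSubgroup, fun h => mem_starSubgroup_of_lead_ne ?_⟩
  rw [h.eq, lead_self_mul]
  simp

theorem lead_star_mul {c : RAAG Γ} (hc : c ∈ starSubgroup Γ v) :
    ∃ n : ℤ, ∀ x, lead Γ v (c * x) = lead Γ v x + n := by
  induction hc using Subgroup.closure_induction with
  | mem c hc =>
    obtain ⟨w, rfl | hw, rfl⟩ := hc
    · exact ⟨1, lead_self_mul Γ w⟩
    · exact ⟨0, fun x => by
        rw [lead_link_mul (Subgroup.subset_closure ⟨w, hw, rfl⟩), add_zero]⟩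
  | one => exact ⟨0, by simp⟩
  | mul c d _ _ hc hd =>
    obtain ⟨n, hn⟩ := hc
    obtain ⟨m, hm⟩ := hd
    exact ⟨m + n, fun x => by rw [mul_assoc, hn, hm, add_assoc]⟩
  | inv c _ hc =>
    obtain ⟨n, hn⟩ := hc
    refine ⟨-n, fun x => ?_⟩
    have := hn (c⁻¹ * x)
    rw [mul_inv_cancel_left] at this
    omega

end Splitting

section RelativeLead

variable {V : Type} {Γ : SimpleGraph V}

theorem raag_induction_right {P : RAAG Γ → Prop} (h1 : P 1)
    (hmul : ∀ x v, P x → P (x * raagGen Γ v)) (hinv : ∀ x v, P x → P (x * (raagGen Γ v)⁻¹))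
    (x : RAAG Γ) : P x := by
  have hx : x ∈ Subgroup.closure (Set.range (raagGen Γ)) := by
    rw [closure_range_raagGen]
    trivial
  induction hx using Subgroup.closure_induction_right with
  | one => exact h1
  | mul_right x _ y hy ih =>
    obtain ⟨v, rfl⟩ := hy
    exact hmul x v ih
  | mul_inv_cancel x _ y hy ih =>
    obtain ⟨v, rfl⟩ := hy
    exact hinv x v ih

variable (Γ)

/-- The leading exponent of `x` with respect to the conjugate `g * v * g⁻¹`, normalised to vanish
at the identity. -/
noncomputable def relLead (v : V) (g x : RAAG Γ) : ℤ := lead Γ v (g⁻¹ * x) - lead Γ v g⁻¹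

variable {Γ} {v w : V} {g h : RAAG Γ}

theorem relLead_at_one : relLead Γ v g 1 = 0 := by
  simp [relLead]

theorem relLead_one_left (x : RAAG Γ) : relLead Γ v 1 x = lead Γ v x := by
  simp [relLead, lead_one]

theorem relLead_conj_mul (x : RAAG Γ) :
    relLead Γ v g (g * raagGen Γ v * g⁻¹ * x) = relLead Γ v g x + 1 := by
  have : g⁻¹ * (g * raagGen Γ v * g⁻¹ * x) = raagGen Γ v * (g⁻¹ * x) := by group
  rw [relLead, this, lead_self_mul, relLead]
  ring

theorem relLead_conj_inv_mul (x : RAAG Γ) :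
    relLead Γ v g ((g * raagGen Γ v * g⁻¹)⁻¹ * x) = relLead Γ v g x - 1 := by
  have := relLead_conj_mul (v := v) (g := g) ((g * raagGen Γ v * g⁻¹)⁻¹ * x)
  rw [mul_inv_cancel_left] at this
  omega

theorem relLead_mul_gen (x : RAAG Γ) (t : V) :
    relLead Γ v g (x * raagGen Γ t) = relLead Γ v g x ∨ (t = v ∧ g⁻¹ * x ∈ starSubgroup Γ v) := by
  by_cases ht : t = v
  · subst ht
    by_cases hx : relLead Γ t g (x * raagGen Γ t) = relLead Γ t g x
    · exact Or.inl hx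
    · refine Or.inr ⟨rfl, mem_starSubgroup_of_lead_ne fun h => hx ?_⟩
      rw [relLead, ← mul_assoc, h, relLead]
  · left
    rw [relLead, ← mul_assoc, lead_mul_of_ne ht, relLead]

theorem relLead_mul_gen_inv (x : RAAG Γ) (t : V) :
    relLead Γ v g (x * (raagGen Γ t)⁻¹) = relLead Γ v g x ∨
      (t = v ∧ g⁻¹ * x ∈ starSubgroup Γ v) := by
  have h := relLead_mul_gen (v := v) (g := g) (x * (raagGen Γ t)⁻¹) t
  rw [inv_mul_cancel_right] at h
  refine h.imp Eq.symm ?_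
  rintro ⟨rfl, hx⟩
  refine ⟨rfl, ?_⟩
  have := mul_mem hx (raagGen_mem_starSubgroup t)
  rwa [← mul_assoc, inv_mul_cancel_right] at this

theorem relLead_mul_of_mem_starSubgroup (hvw : v ∉ Gstar Γ w) {c : RAAG Γ}
    (hc : c ∈ starSubgroup Γ w) (x : RAAG Γ) : relLead Γ v g (x * c) = relLead Γ v g x := by
  induction hc using Subgroup.closure_induction generalizing x with
  | mem c hc =>
    obtain ⟨t, ht, rfl⟩ := hc
    exact (relLead_mul_gen x t).resolve_right fun h => hvw (h.1 ▸ ht)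
  | one => rw [mul_one]
  | mul c d _ _ hc hd => rw [← mul_assoc, hd, hc]
  | inv c _ hc => rw [← hc (x * c⁻¹), inv_mul_cancel_right]

theorem relLead_eq_of_mem_strip (hvw : v ∉ Gstar Γ w) {y : RAAG Γ}
    (hy : h⁻¹ * y ∈ starSubgroup Γ w) : relLead Γ v g y = relLead Γ v g h := by
  rw [← relLead_mul_of_mem_starSubgroup hvw hy h, mul_inv_cancel_left]

theorem exists_mem_both_strips
    (hc : Commute (g * raagGen Γ v * g⁻¹) (h * raagGen Γ w * h⁻¹)) :
    ∃ x, g⁻¹ * x ∈ starSubgroup Γ v ∧ h⁻¹ * x ∈ starSubgroup Γ w := by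
  by_contra! hno
  have hconst : ∀ c ∈ starSubgroup Γ v, relLead Γ w h (g * c) = relLead Γ w h g := by
    intro c hc
    induction hc using Subgroup.closure_induction_right with
    | one => rw [mul_one]
    | mul_right c hc s hs ih =>
      obtain ⟨t, -, rfl⟩ := hs
      rw [← ih, ← mul_assoc]
      exact (relLead_mul_gen _ t).resolve_right fun h =>
        hno (g * c) (by rwa [inv_mul_cancel_left]) h.2
    | mul_inv_cancel c hc s hs ih =>
      obtain ⟨t, -, rfl⟩ := hs
      rw [← ih, ← mul_assoc]
      exact (relLead_mul_gen_inv _ t).resolve_right fun h =>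
        hno (g * c) (by rwa [inv_mul_cancel_left]) h.2
  have hmem : g⁻¹ * (h * raagGen Γ w * h⁻¹) * g ∈ starSubgroup Γ v := by
    rw [mem_starSubgroup_iff_commute]
    have := hc.symm.map (MulAut.conj g⁻¹).toMonoidHom
    simpa [MulAut.conj_apply, mul_assoc] using this
  have h1 := hconst _ hmem
  rw [show g * (g⁻¹ * (h * raagGen Γ w * h⁻¹) * g) = h * raagGen Γ w * h⁻¹ * g by group,
    relLead_conj_mul] at h1
  omega

theorem relLead_adj_conj_mul (hvw : Γ.Adj v w)
    (hc : Commute (g * raagGen Γ v * g⁻¹) (h * raagGen Γ w * h⁻¹)) (x : RAAG Γ) :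
    relLead Γ v g (h * raagGen Γ w * h⁻¹ * x) = relLead Γ v g x := by
  obtain ⟨y, hy, hy'⟩ := exists_mem_both_strips hc
  have hw : h * raagGen Γ w * h⁻¹ = y * raagGen Γ w * y⁻¹ := by
    have := (mem_starSubgroup_iff_commute.1 hy').eq
    calc h * raagGen Γ w * h⁻¹ = h * (raagGen Γ w * (h⁻¹ * y)) * y⁻¹ := by group
      _ = h * (h⁻¹ * y * raagGen Γ w) * y⁻¹ := by rw [this]
      _ = _ := by group
  set c := g⁻¹ * y with hcdef
  obtain ⟨n, hn⟩ := lead_star_mul hy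
  have hlink : raagGen Γ w ∈ linkSubgroup Γ v := Subgroup.subset_closure ⟨w, hvw, rfl⟩
  rw [relLead, relLead, hw,
    show g⁻¹ * (y * raagGen Γ w * y⁻¹ * x) = c * (raagGen Γ w * (y⁻¹ * x)) by rw [hcdef]; group,
    show g⁻¹ * x = c * (y⁻¹ * x) by rw [hcdef]; group, hn, hn, lead_link_mul hlink]

theorem relLead_eq_zero_or (hvw : v ∉ Gstar Γ w) (hwv : w ∉ Gstar Γ v)
    (h1 : relLead Γ v g h = 0) (h2 : relLead Γ w h g = 0) (y : RAAG Γ) :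
    relLead Γ v g y = 0 ∨ relLead Γ w h y = 0 := by
  have hv : ∀ y, g⁻¹ * y ∈ starSubgroup Γ v → relLead Γ w h y = 0 := fun y hy => by
    rw [relLead_eq_of_mem_strip hwv hy, h2]
  have hw : ∀ y, h⁻¹ * y ∈ starSubgroup Γ w → relLead Γ v g y = 0 := fun y hy => by
    rw [relLead_eq_of_mem_strip hvw hy, h1]
  induction y using raag_induction_right with
  | h1 => exact Or.inl relLead_at_one
  | hmul y t ih =>
    rcases relLead_mul_gen (v := v) (g := g) y t with ha | ⟨rfl, ha⟩
    · rcases relLead_mul_gen (v := w) (g := h) y t with hb | ⟨rfl, hb⟩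
      · rwa [ha, hb]
      · exact Or.inl (ha.trans (hw y hb))
    · right
      refine hv _ ?_
      rw [← mul_assoc]
      exact mul_mem ha (raagGen_mem_starSubgroup t)
  | hinv y t ih =>
    rcases relLead_mul_gen_inv (v := v) (g := g) y t with ha | ⟨rfl, ha⟩
    · rcases relLead_mul_gen_inv (v := w) (g := h) y t with hb | ⟨rfl, hb⟩
      · rwa [ha, hb]
      · exact Or.inl (ha.trans (hw y hb))
    · right
      refine hv _ ?_
      rw [← mul_assoc]
      exact mul_mem ha (inv_mem (raagGen_mem_starSubgroup t))

end RelativeLead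

section WordLength

variable {V : Type} (Γ : SimpleGraph V)

/-- The element of `A(Γ)` represented by a word in the generators and their inverses. -/
def raagWord (L : List (V × Bool)) : RAAG Γ :=
  (L.map fun p => if p.2 then raagGen Γ p.1 else (raagGen Γ p.1)⁻¹).prod

/-- The word length of an element of `A(Γ)`. -/
noncomputable def raagLength (x : RAAG Γ) : ℕ :=
  sInf {n | ∃ L : List (V × Bool), L.length = n ∧ raagWord Γ L = x}

variable {Γ}

theorem exists_raagWord_eq (x : RAAG Γ) : ∃ L : List (V × Bool), raagWord Γ L = x := by
  induction x using raag_induction_right with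
  | h1 => exact ⟨[], rfl⟩
  | hmul x v ih =>
    obtain ⟨L, rfl⟩ := ih
    exact ⟨L ++ [(v, true)], by simp [raagWord]⟩
  | hinv x v ih =>
    obtain ⟨L, rfl⟩ := ih
    exact ⟨L ++ [(v, false)], by simp [raagWord]⟩

theorem exists_raagWord_length_eq (x : RAAG Γ) :
    ∃ L : List (V × Bool), L.length = raagLength Γ x ∧ raagWord Γ L = x := by
  obtain ⟨L, hL⟩ := exists_raagWord_eq x
  exact Nat.sInf_mem (s := {n | ∃ L : List (V × Bool), L.length = n ∧ raagWord Γ L = x})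
    ⟨_, L, rfl, hL⟩

theorem raagLength_le (L : List (V × Bool)) : raagLength Γ (raagWord Γ L) ≤ L.length :=
  Nat.sInf_le ⟨L, rfl, rfl⟩

theorem exists_shorter_word {v : V} {g : RAAG Γ} (L : List (V × Bool)) :
    (0 < relLead Γ v g (raagWord Γ L) → ∃ L' : List (V × Bool), L'.length < L.length ∧
      raagWord Γ L' = (g * raagGen Γ v * g⁻¹)⁻¹ * raagWord Γ L) ∧
    (relLead Γ v g (raagWord Γ L) < 0 → ∃ L' : List (V × Bool), L'.length < L.length ∧
      raagWord Γ L' = g * raagGen Γ v * g⁻¹ * raagWord Γ L) := by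
  induction L using List.reverseRecOn with
  | nil => simp [raagWord, relLead_at_one]
  | append_singleton L p ih =>
    have hext : ∀ L : List (V × Bool), raagWord Γ (L ++ [p]) =
        raagWord Γ L * if p.2 then raagGen Γ p.1 else (raagGen Γ p.1)⁻¹ := by
      intro L
      simp [raagWord]
    have hcross : relLead Γ v g (raagWord Γ (L ++ [p])) = relLead Γ v g (raagWord Γ L) ∨
        (p.1 = v ∧ g⁻¹ * raagWord Γ L ∈ starSubgroup Γ v) := by
      rw [hext]
      cases p.2
      · exact relLead_mul_gen_inv _ _
      · exact relLead_mul_gen _ _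
    rcases hcross with hcross | ⟨rfl, hmem⟩
    · rw [hcross]
      constructor
      · intro h
        obtain ⟨L', h1, h2⟩ := ih.1 h
        exact ⟨L' ++ [p], by simpa using h1, by rw [hext, h2, hext, mul_assoc]⟩
      · intro h
        obtain ⟨L', h1, h2⟩ := ih.2 h
        exact ⟨L' ++ [p], by simpa using h1, by rw [hext, h2, hext, mul_assoc]⟩
    · have hstrip : raagWord Γ L * raagGen Γ p.1 =
          g * raagGen Γ p.1 * g⁻¹ * raagWord Γ L := by
        have := (mem_starSubgroup_iff_commute.1 hmem).eq
        calc raagWord Γ L * raagGen Γ p.1 = g * (g⁻¹ * raagWord Γ L * raagGen Γ p.1) := by group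
          _ = _ := by rw [this]; group
      have hstrip' : raagWord Γ L * (raagGen Γ p.1)⁻¹ =
          (g * raagGen Γ p.1 * g⁻¹)⁻¹ * raagWord Γ L := by
        rw [eq_inv_mul_iff_mul_eq, ← mul_assoc, ← hstrip, mul_inv_cancel_right]
      rw [hext]
      cases hp : p.2
      · simp only [Bool.false_eq_true, if_false, hstrip', relLead_conj_inv_mul]
        constructor
        · intro h
          obtain ⟨L', h1, h2⟩ := ih.1 (by omega)
          refine ⟨L' ++ [p], by simpa using h1, ?_⟩
          rw [hext, h2, hp, mul_assoc]
          simp only [Bool.false_eq_true, if_false, hstrip']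
        · intro h
          exact ⟨L, by simp, by group⟩
      · simp only [if_true, hstrip, relLead_conj_mul]
        constructor
        · intro h
          exact ⟨L, by simp, by group⟩
        · intro h
          obtain ⟨L', h1, h2⟩ := ih.2 (by omega)
          refine ⟨L' ++ [p], by simpa using h1, ?_⟩
          rw [hext, h2, hp, mul_assoc]
          simp only [if_true, hstrip]

theorem raagLength_conj_inv_mul_lt {v : V} {g x : RAAG Γ} (h : 0 < relLead Γ v g x) :
    raagLength Γ ((g * raagGen Γ v * g⁻¹)⁻¹ * x) < raagLength Γ x := by
  obtain ⟨L, hL, rfl⟩ := exists_raagWord_length_eq x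
  obtain ⟨L', h1, h2⟩ := (exists_shorter_word L).1 h
  rw [← hL, ← h2]
  exact (raagLength_le L').trans_lt h1

theorem raagLength_conj_mul_lt {v : V} {g x : RAAG Γ} (h : relLead Γ v g x < 0) :
    raagLength Γ (g * raagGen Γ v * g⁻¹ * x) < raagLength Γ x := by
  obtain ⟨L, hL, rfl⟩ := exists_raagWord_length_eq x
  obtain ⟨L', h1, h2⟩ := (exists_shorter_word L).2 h
  rw [← hL, ← h2]
  exact (raagLength_le L').trans_lt h1

theorem exists_leading_letter {x : RAAG Γ} (hx : x ≠ 1) :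
    ∃ v y, raagLength Γ y < raagLength Γ x ∧ lead Γ v x ≠ 0 ∧
      (x = raagGen Γ v * y ∨ x = (raagGen Γ v)⁻¹ * y) := by
  obtain ⟨L, hL, rfl⟩ := exists_raagWord_length_eq x
  rcases L with _ | ⟨⟨v, b⟩, L⟩
  · exact absurd rfl hx
  have hlt : raagLength Γ (raagWord Γ L) < raagLength Γ (raagWord Γ ((v, b) :: L)) := by
    rw [← hL]
    exact (raagLength_le L).trans_lt (by simp)
  have hpos := @raagLength_conj_inv_mul_lt V Γ v 1 (raagWord Γ L)
  have hneg := @raagLength_conj_mul_lt V Γ v 1 (raagWord Γ L)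
  have hinc := @relLead_conj_mul V Γ v 1 (raagWord Γ L)
  have hdec := @relLead_conj_inv_mul V Γ v 1 (raagWord Γ L)
  simp only [one_mul, inv_one, mul_one, relLead_one_left] at hpos hneg hinc hdec
  refine ⟨v, raagWord Γ L, hlt, ?_, ?_⟩
  · intro h0
    cases b
    · have hcons : raagWord Γ ((v, false) :: L) = (raagGen Γ v)⁻¹ * raagWord Γ L := by
        simp [raagWord]
      rw [hcons] at h0 hlt
      have := hpos (by omega)
      omega
    · have hcons : raagWord Γ ((v, true) :: L) = raagGen Γ v * raagWord Γ L := by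
        simp [raagWord]
      rw [hcons] at h0 hlt
      have := hneg (by omega)
      omega
  · cases b <;> simp [raagWord]

end WordLength

section Rigidity

variable {V : Type} {Γ : SimpleGraph V}

theorem mem_Gstar_comm {v w : V} : v ∈ Gstar Γ w ↔ w ∈ Gstar Γ v := by
  simp [Gstar, eq_comm, SimpleGraph.adj_comm]

theorem raagGen_ne_one (v : V) : raagGen Γ v ≠ 1 := by
  intro h
  have := lead_self_mul Γ v 1
  rw [h, mul_one] at this
  omega

variable {φ : RAAG Γ →* RAAG Γ} {g : V → RAAG Γ}

theorem relLead_map_eq_lead (hφ : ∀ v, φ (raagGen Γ v) = g v * raagGen Γ v * (g v)⁻¹)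
    (hg : ∀ v w, w ∉ Gstar Γ v → relLead Γ v (g v) (g w) = 0) (x : RAAG Γ) (v : V) :
    relLead Γ v (g v) (φ x) = lead Γ v x := by
  induction hn : raagLength Γ x using Nat.strong_induction_on generalizing x v with
  | _ n ih =>
  subst hn
  by_cases hx : x = 1
  · subst hx
    rw [map_one, relLead_at_one, lead_one]
  obtain ⟨w, y, hy, hw, hxy⟩ := exists_leading_letter hx
  have ihy := fun v => ih _ hy y v rfl
  have hself : relLead Γ w (g w) (φ x) = lead Γ w x := by
    rcases hxy with rfl | rfl
    · rw [map_mul, hφ, relLead_conj_mul, lead_self_mul, ihy]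
    · have h1 := lead_self_mul Γ w ((raagGen Γ w)⁻¹ * y)
      rw [mul_inv_cancel_left] at h1
      rw [map_mul, map_inv, hφ, relLead_conj_inv_mul, ihy, h1]
      omega
  by_cases hvw : w ∈ Gstar Γ v
  · rcases hvw with rfl | hvw
    · exact hself
    · have hc : Commute (g v * raagGen Γ v * (g v)⁻¹) (g w * raagGen Γ w * (g w)⁻¹) := by
        rw [← hφ, ← hφ]
        exact (raagGen_commute hvw).map φ
      have hlink : raagGen Γ w ∈ linkSubgroup Γ v := Subgroup.subset_closure ⟨w, hvw, rfl⟩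
      rcases hxy with rfl | rfl
      · rw [map_mul, hφ, relLead_adj_conj_mul hvw hc, lead_link_mul hlink, ihy]
      · rw [lead_link_mul (inv_mem hlink), ← ihy, ← relLead_adj_conj_mul hvw hc (φ _), ← hφ,
          ← map_mul, mul_inv_cancel_left]
  · have hwv : v ∉ Gstar Γ w := fun h => hvw (mem_Gstar_comm.1 h)
    have h1 := relLead_eq_zero_or hwv hvw (hg v w hvw) (hg w v hwv) (φ x)
    have h2 := relLead_eq_zero_or (g := 1) (h := 1) hwv hvw relLead_at_one relLead_at_one x
    rw [relLead_one_left, relLead_one_left] at h2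
    rw [hself] at h1
    rw [h1.resolve_right hw, h2.resolve_right hw]

theorem map_raagGen_eq_of_relLead_eq_zero (hsurj : Function.Surjective φ)
    (hφ : ∀ v, φ (raagGen Γ v) = g v * raagGen Γ v * (g v)⁻¹)
    (hg : ∀ v w, w ∉ Gstar Γ v → relLead Γ v (g v) (g w) = 0) (s : V) :
    φ (raagGen Γ s) = raagGen Γ s := by
  obtain ⟨x, hx⟩ := hsurj (raagGen Γ s)
  have hx1 : x ≠ 1 := by
    rintro rfl
    exact raagGen_ne_one s (by rw [← hx, map_one])
  obtain ⟨v, -, -, hv, -⟩ := exists_leading_letter hx1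
  rw [← relLead_map_eq_lead hφ hg, hx] at hv
  have hcross := relLead_mul_gen (v := v) (g := g v) 1 s
  rw [one_mul, relLead_at_one, mul_one] at hcross
  obtain ⟨rfl, hmem⟩ := hcross.resolve_left hv
  rw [hφ, (mem_starSubgroup_iff_commute.1 (inv_mem_iff.1 hmem)).eq, mul_inv_cancel_right]

end Rigidity

section Components

variable {V : Type} {Γ : SimpleGraph V} {S K K' : Set V}

theorem IsCompOf.subset (h : IsCompOf Γ S K) : K ⊆ S := by
  obtain ⟨c, rfl⟩ := h
  rintro _ ⟨v, -, rfl⟩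
  exact v.2

theorem IsCompOf.nonempty (h : IsCompOf Γ S K) : K.Nonempty := by
  obtain ⟨c, rfl⟩ := h
  exact c.nonempty_supp.image _

theorem IsCompOf.mem_of_adj (h : IsCompOf Γ S K) {v w : V} (hv : v ∈ K) (hw : w ∈ S)
    (hvw : Γ.Adj v w) : w ∈ K := by
  obtain ⟨c, rfl⟩ := h
  obtain ⟨v, hv, rfl⟩ := hv
  refine ⟨⟨w, hw⟩, ?_, rfl⟩
  rw [SimpleGraph.ConnectedComponent.mem_supp_iff] at hv ⊢
  rw [← hv]
  exact SimpleGraph.ConnectedComponent.sound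
    (SimpleGraph.Adj.reachable (by simpa using hvw.symm))

theorem IsCompOf.eq_of_mem (h : IsCompOf Γ S K) (h' : IsCompOf Γ S K') {v : V} (hv : v ∈ K)
    (hv' : v ∈ K') : K = K' := by
  obtain ⟨c, rfl⟩ := h
  obtain ⟨c', rfl⟩ := h'
  obtain ⟨v, hv, rfl⟩ := hv
  obtain ⟨v', hv', hvv⟩ := hv'
  obtain rfl := Subtype.ext hvv
  rw [SimpleGraph.ConnectedComponent.mem_supp_iff] at hv hv'
  rw [← hv, ← hv']

theorem exists_isCompOf_mem {v : V} (hv : v ∈ S) : ∃ K, IsCompOf Γ S K ∧ v ∈ K :=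
  ⟨_, ⟨(Γ.induce S).connectedComponentMk ⟨v, hv⟩, rfl⟩, ⟨v, hv⟩, rfl, rfl⟩

theorem IsCompOf.induction (h : IsCompOf Γ S K) {P : V → Prop} {v : V} (hv : v ∈ K) (hP : P v)
    (hstep : ∀ x ∈ S, ∀ y ∈ S, Γ.Adj x y → P x → P y) {w : V} (hw : w ∈ K) : P w := by
  obtain ⟨c, rfl⟩ := h
  obtain ⟨v, hv, rfl⟩ := hv
  obtain ⟨w, hw, rfl⟩ := hw
  rw [SimpleGraph.ConnectedComponent.mem_supp_iff] at hv hw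
  obtain ⟨p⟩ := SimpleGraph.ConnectedComponent.exact (hv.trans hw.symm)
  induction p with
  | nil => exact hP
  | cons hadj _ ih =>
    rename_i x y z _
    refine ih ?_ ?_ hw
    · rw [← hv]
      exact SimpleGraph.ConnectedComponent.sound hadj.symm.reachable
    · exact hstep x x.2 y y.2 (by simpa using hadj) hP

/-- Without separating intersections of links, a component of the complement of the star of `a`
missing `b` only meets a component of the complement of the star of `b` if the latter contains
`a`. -/
theorem mem_of_no_sil (hΓ : ¬HasSIL Γ) {a b v : V} {K L : Set V} (hab : a ≠ b)
    (hadj : ¬Γ.Adj a b) (hK : IsCompOf Γ (Gstar Γ a)ᶜ K) (hL : IsCompOf Γ (Gstar Γ b)ᶜ L)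
    (hb : b ∉ K) (hvK : v ∈ K) (hvL : v ∈ L) : a ∈ L := by
  by_contra ha
  have haS : a ∈ (Gstar Γ b)ᶜ := by
    simp [Gstar, hab, SimpleGraph.adj_comm, hadj]
  have hbS : b ∈ (Gstar Γ a)ᶜ := by
    simp [Gstar, hab.symm, hadj]
  have key : ∀ {a b : V} {K L : Set V}, IsCompOf Γ (Gstar Γ a)ᶜ K →
      IsCompOf Γ (Gstar Γ b)ᶜ L → a ∈ (Gstar Γ b)ᶜ → a ∉ L → ∀ x ∈ K, x ∈ L →
      ∀ y, Γ.Adj x y → y ∉ Γ.neighborSet a ∩ Γ.neighborSet b → b ∉ Gstar Γ a → y ∈ K := by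
    intro a b K L hK hL haS ha x hxK hxL y hxy hy hb
    refine hK.mem_of_adj hxK ?_ hxy
    rintro (rfl | hya)
    · exact hK.subset hxK (Or.inr hxy.symm)
    · refine ha (hL.mem_of_adj (hL.mem_of_adj hxL ?_ hxy) haS hya.symm)
      rintro (rfl | hyb)
      · exact hb (Or.inr hya)
      · exact hy ⟨hya, hyb⟩
  have hvS : v ∈ (Γ.neighborSet a ∩ Γ.neighborSet b)ᶜ := fun h => hK.subset hvK (Or.inr h.1)
  obtain ⟨M, hM, hvM⟩ := exists_isCompOf_mem (Γ := Γ) hvS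
  have hsub : ∀ x ∈ M, x ∈ K ∧ x ∈ L := fun x hx =>
    hM.induction (P := fun x => x ∈ K ∧ x ∈ L) hvM ⟨hvK, hvL⟩
      (fun x _ y hy hxy h => ⟨key hK hL haS ha x h.1 h.2 y hxy hy hbS,
        key hL hK hbS hb x h.2 h.1 y hxy (fun h => hy h.symm) haS⟩) hx
  exact hΓ ⟨a, b, hab, hadj, M, hM, fun h => ha (hsub a h).2, fun h => hb (hsub b h).1⟩

end Components

section PartialConjugation

variable {V : Type} {Γ : SimpleGraph V}

theorem raagGen_commute_of_mem_Gstar {a w : V} (h : w ∈ Gstar Γ a) :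
    Commute (raagGen Γ a) (raagGen Γ w) := by
  rcases h with rfl | h
  · exact Commute.refl _
  · exact raagGen_commute h

theorem fst_notMem_snd (p : PCSet Γ) : p.1.1 ∉ p.1.2 := fun h =>
  (IsCompOf.subset p.2 h) (Or.inl rfl)

open Classical in
/-- The endomorphism conjugating the generators in the domain of `p` by the `n`-th power of the
acting letter of `p`. -/
noncomputable def pcHom (p : PCSet Γ) (n : ℤ) : RAAG Γ →* RAAG Γ :=
  raagLift (fun v => if v ∈ p.1.2 then MulAut.conj (raagGen Γ p.1.1 ^ n) (raagGen Γ v)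
    else raagGen Γ v) (by
    have key : ∀ v w, Γ.Adj v w → v ∈ p.1.2 → w ∉ p.1.2 →
        Commute (MulAut.conj (raagGen Γ p.1.1 ^ n) (raagGen Γ v)) (raagGen Γ w) := by
      intro v w hvw hv hw
      have hw' : w ∈ Gstar Γ p.1.1 := by
        by_contra h
        exact hw (IsCompOf.mem_of_adj p.2 hv h hvw)
      have h1 : Commute (raagGen Γ p.1.1 ^ n) (raagGen Γ w) :=
        (raagGen_commute_of_mem_Gstar hw').zpow_left n
      rw [MulAut.conj_apply]
      exact (h1.mul_left (raagGen_commute hvw)).mul_left h1.inv_left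
    intro v w hvw
    by_cases hv : v ∈ p.1.2 <;> by_cases hw : w ∈ p.1.2 <;> simp only [hv, hw, if_true, if_false]
    · exact (raagGen_commute hvw).map _
    · exact key v w hvw hv hw
    · exact (key w v hvw.symm hw hv).symm
    · exact raagGen_commute hvw)

theorem pcHom_of_mem (p : PCSet Γ) (n : ℤ) {v : V} (hv : v ∈ p.1.2) :
    pcHom p n (raagGen Γ v) = raagGen Γ p.1.1 ^ n * raagGen Γ v * (raagGen Γ p.1.1 ^ n)⁻¹ := by
  rw [pcHom, raagLift_gen, if_pos hv, MulAut.conj_apply]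

theorem pcHom_of_notMem (p : PCSet Γ) (n : ℤ) {v : V} (hv : v ∉ p.1.2) :
    pcHom p n (raagGen Γ v) = raagGen Γ v := by
  simp [pcHom, hv]

theorem pcHom_comp (p : PCSet Γ) (n m : ℤ) : (pcHom p n).comp (pcHom p m) = pcHom p (n + m) := by
  refine raag_hom_ext fun v => ?_
  rw [MonoidHom.comp_apply]
  by_cases hv : v ∈ p.1.2
  · simp only [pcHom_of_mem p _ hv, map_mul, map_inv, map_zpow,
      pcHom_of_notMem p _ (fst_notMem_snd p)]
    group
  · simp only [pcHom_of_notMem p _ hv]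

theorem pcHom_zero (p : PCSet Γ) : pcHom p 0 = MonoidHom.id _ := by
  refine raag_hom_ext fun v => ?_
  by_cases hv : v ∈ p.1.2
  · simp [pcHom_of_mem p _ hv]
  · simp [pcHom_of_notMem p _ hv]

/-- The `n`-th power of the partial conjugation determined by `p`, as an automorphism. -/
noncomputable def pcAut (p : PCSet Γ) (n : ℤ) : MulAut (RAAG Γ) :=
  MonoidHom.toMulEquiv (pcHom p n) (pcHom p (-n))
    (by rw [pcHom_comp, neg_add_cancel, pcHom_zero])
    (by rw [pcHom_comp, add_neg_cancel, pcHom_zero])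

theorem pcAut_of_mem (p : PCSet Γ) (n : ℤ) {v : V} (hv : v ∈ p.1.2) :
    pcAut p n (raagGen Γ v) = raagGen Γ p.1.1 ^ n * raagGen Γ v * (raagGen Γ p.1.1 ^ n)⁻¹ :=
  pcHom_of_mem p n hv

theorem pcAut_of_notMem (p : PCSet Γ) (n : ℤ) {v : V} (hv : v ∉ p.1.2) :
    pcAut p n (raagGen Γ v) = raagGen Γ v :=
  pcHom_of_notMem p n hv

theorem pcAut_inv (p : PCSet Γ) (n : ℤ) : (pcAut p n)⁻¹ = pcAut p (-n) := by
  rw [inv_eq_iff_mul_eq_one]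
  refine raag_aut_ext fun v => ?_
  change ((pcHom p n).comp (pcHom p (-n))) (raagGen Γ v) = raagGen Γ v
  rw [pcHom_comp, add_neg_cancel, pcHom_zero, MonoidHom.id_apply]

theorem pcAut_mem_PSA (p : PCSet Γ) (n : ℤ) : pcAut p n ∈ PSA Γ := by
  intro v
  by_cases hv : v ∈ p.1.2
  · rw [pcAut_of_mem p n hv]
    exact isConj_iff.2 ⟨_, rfl⟩
  · rw [pcAut_of_notMem p n hv]

theorem pcAut_commute_of_notMem (hΓ : ¬HasSIL Γ) (p q : PCSet Γ) (h : q.1.1 ∉ p.1.2) :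
    Commute (pcAut p 1) (pcAut q 1) := by
  obtain ⟨⟨a, K⟩, hp⟩ := p
  obtain ⟨⟨b, L⟩, hq⟩ := q
  set p : PCSet Γ := ⟨(a, K), hp⟩ with hpdef
  set q : PCSet Γ := ⟨(b, L), hq⟩ with hqdef
  replace hp : IsCompOf Γ (Gstar Γ a)ᶜ K := hp
  replace hq : IsCompOf Γ (Gstar Γ b)ᶜ L := hq
  replace h : b ∉ K := h
  have haK : a ∉ K := fst_notMem_snd p
  have hbL : b ∉ L := fst_notMem_snd q
  have p1 : ∀ v ∈ K, pcAut p 1 (raagGen Γ v) = raagGen Γ a * raagGen Γ v * (raagGen Γ a)⁻¹ :=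
    fun v hv => by simpa using pcAut_of_mem p 1 hv
  have q1 : ∀ v ∈ L, pcAut q 1 (raagGen Γ v) = raagGen Γ b * raagGen Γ v * (raagGen Γ b)⁻¹ :=
    fun v hv => by simpa using pcAut_of_mem q 1 hv
  have p0 : ∀ v ∉ K, pcAut p 1 (raagGen Γ v) = raagGen Γ v := fun v hv => pcAut_of_notMem p 1 hv
  have q0 : ∀ v ∉ L, pcAut q 1 (raagGen Γ v) = raagGen Γ v := fun v hv => pcAut_of_notMem q 1 hv
  have hcases : (a ∉ L ∧ (Commute (raagGen Γ a) (raagGen Γ b) ∨ ∀ v ∈ K, v ∉ L)) ∨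
      (a ∈ L ∧ K ⊆ L) := by
    by_cases hab : b ∈ Gstar Γ a
    · exact Or.inl ⟨fun haL => hq.subset haL (mem_Gstar_comm.1 hab),
        Or.inl (raagGen_commute_of_mem_Gstar hab)⟩
    · have hne : a ≠ b := fun h => hab (Or.inl h.symm)
      have hadj : ¬Γ.Adj a b := fun h => hab (Or.inr h)
      by_cases haL : a ∈ L
      · refine Or.inr ⟨haL, fun v hv => ?_⟩
        have hvS : v ∈ (Gstar Γ b)ᶜ := by
          rintro (rfl | hvb)
          · exact h hv
          · exact h (hp.mem_of_adj hv hab hvb.symm)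
        obtain ⟨L', hL', hvL'⟩ := exists_isCompOf_mem (Γ := Γ) hvS
        have haL' := mem_of_no_sil hΓ hne hadj hp hL' h hv hvL'
        rwa [hq.eq_of_mem hL' haL haL']
      · exact Or.inl ⟨haL, Or.inr fun v hv hvL =>
          haL (mem_of_no_sil hΓ hne hadj hp hq h hv hvL)⟩
  refine raag_aut_ext fun v => ?_
  rw [MulAut.mul_apply, MulAut.mul_apply]
  rcases hcases with ⟨haL, hc⟩ | ⟨haL, hKL⟩
  · by_cases hvK : v ∈ K <;> by_cases hvL : v ∈ L
    · have hc := hc.resolve_right fun hd => hd v hvK hvL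
      simp only [p1 v hvK, q1 v hvL, map_mul, map_inv, p0 b h, q0 a haL]
      have := hc.eq
      calc _ = (raagGen Γ b * raagGen Γ a) * raagGen Γ v *
            (raagGen Γ b * raagGen Γ a)⁻¹ := by group
        _ = _ := by rw [← this]; group
    all_goals simp [p1, q1, p0, q0, hvK, hvL, h, haL]
  · by_cases hvK : v ∈ K
    · simp only [p1 v hvK, q1 v (hKL hvK), map_mul, map_inv, p0 b h, q1 a haL]
      group
    · by_cases hvL : v ∈ L <;> simp [p0, q1, q0, hvK, hvL, h]

end PartialConjugation

section Generation

variable {V : Type} {Γ : SimpleGraph V}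

variable (Γ) in
/-- The graph on the partial conjugations, two of which are non-adjacent when each acting letter
lies in the domain of the other one. -/
def pcGraph : SimpleGraph (PCSet Γ) where
  Adj p q := p ≠ q ∧ ¬(q.1.1 ∈ p.1.2 ∧ p.1.1 ∈ q.1.2)
  symm := ⟨fun _ _ h => ⟨h.1.symm, fun h' => h.2 h'.symm⟩⟩
  loopless := ⟨fun _ h => h.1 rfl⟩

/-- The homomorphism from the right-angled Artin group on the partial conjugations. -/
noncomputable def pcRep (hΓ : ¬HasSIL Γ) : RAAG (pcGraph Γ) →* MulAut (RAAG Γ) :=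
  raagLift (fun p => pcAut p 1) (by
    rintro p q ⟨-, h⟩
    rcases not_and_or.1 h with h | h
    · exact pcAut_commute_of_notMem hΓ p q h
    · exact (pcAut_commute_of_notMem hΓ q p h).symm)

@[simp]
theorem pcRep_gen (hΓ : ¬HasSIL Γ) (p : PCSet Γ) :
    pcRep hΓ (raagGen (pcGraph Γ) p) = pcAut p 1 :=
  raagLift_gen _ _ p

theorem pcRep_range_le (hΓ : ¬HasSIL Γ) : (pcRep hΓ).range ≤ PSA Γ := by
  rw [MonoidHom.range_eq_map, ← closure_range_raagGen, MonoidHom.map_closure,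
    Subgroup.closure_le]
  rintro _ ⟨_, ⟨p, rfl⟩, rfl⟩
  rw [pcRep_gen]
  exact pcAut_mem_PSA p 1

/-- The least length of an element conjugating the generator `w` to its image under `φ`. -/
noncomputable def conjLength (φ : MulAut (RAAG Γ)) (w : V) : ℕ :=
  sInf {n | ∃ x, x * raagGen Γ w * x⁻¹ = φ (raagGen Γ w) ∧ raagLength Γ x = n}

theorem conjLength_le {φ : MulAut (RAAG Γ)} {w : V} {x : RAAG Γ}
    (h : x * raagGen Γ w * x⁻¹ = φ (raagGen Γ w)) : conjLength φ w ≤ raagLength Γ x :=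
  Nat.sInf_le ⟨x, h, rfl⟩

theorem exists_conjLength_eq {φ : MulAut (RAAG Γ)} (hφ : φ ∈ PSA Γ) (w : V) :
    ∃ x, x * raagGen Γ w * x⁻¹ = φ (raagGen Γ w) ∧ raagLength Γ x = conjLength φ w := by
  obtain ⟨x, hx⟩ := isConj_iff.1 (hφ w)
  exact Nat.sInf_mem
    (s := {n | ∃ x, x * raagGen Γ w * x⁻¹ = φ (raagGen Γ w) ∧ raagLength Γ x = n}) ⟨_, x, hx, rfl⟩

theorem exists_pcAut_decreasing {φ : MulAut (RAAG Γ)} (hφ : φ ∈ PSA Γ) (hne : φ ≠ 1) :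
    ∃ (p : PCSet Γ) (n : ℤ), (n = 1 ∨ n = -1) ∧
      ∀ w ∈ p.1.2, conjLength (φ * pcAut p n) w < conjLength φ w := by
  choose g hg hlen using exists_conjLength_eq hφ
  have hv : ∃ v w, w ∉ Gstar Γ v ∧ relLead Γ v (g v) (g w) ≠ 0 := by
    by_contra! h
    exact hne (raag_aut_ext fun s => map_raagGen_eq_of_relLead_eq_zero (φ := φ.toMonoidHom)
      φ.surjective (fun v => (hg v).symm) h s)
  obtain ⟨v, w₀, hw₀, hn⟩ := hv
  obtain ⟨K, hK, hw₀K⟩ := exists_isCompOf_mem (Γ := Γ) (S := (Gstar Γ v)ᶜ) hw₀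
  have hconst : ∀ w ∈ K, relLead Γ v (g v) (g w) = relLead Γ v (g v) (g w₀) := by
    intro w hw
    refine hK.induction (P := fun w => relLead Γ v (g v) (g w) = relLead Γ v (g v) (g w₀))
      hw₀K rfl ?_ hw
    intro x hx y hy hxy h
    have hc : Commute (g x * raagGen Γ x * (g x)⁻¹) (g y * raagGen Γ y * (g y)⁻¹) := by
      rw [hg, hg]
      exact (raagGen_commute hxy).map φ
    obtain ⟨z, hzx, hzy⟩ := exists_mem_both_strips hc
    rw [← h, ← relLead_eq_of_mem_strip (fun h => hx (mem_Gstar_comm.1 h)) hzx,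
      ← relLead_eq_of_mem_strip (fun h => hy (mem_Gstar_comm.1 h)) hzy]
  have himage : ∀ n : ℤ, ∀ w ∈ K, (g v * raagGen Γ v * (g v)⁻¹) ^ n * g w * raagGen Γ w *
      ((g v * raagGen Γ v * (g v)⁻¹) ^ n * g w)⁻¹ =
      (φ * pcAut ⟨(v, K), hK⟩ n) (raagGen Γ w) := by
    intro n w hw
    rw [MulAut.mul_apply, pcAut_of_mem _ n hw, map_mul, map_mul, map_inv, map_zpow, ← hg, ← hg]
    group
  rcases lt_or_gt_of_ne hn with hn | hn
  · refine ⟨⟨(v, K), hK⟩, 1, Or.inl rfl, fun w hw => ?_⟩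
    refine (conjLength_le (himage 1 w hw)).trans_lt ?_
    rw [← hlen w, zpow_one]
    exact raagLength_conj_mul_lt (by rw [hconst w hw]; exact hn)
  · refine ⟨⟨(v, K), hK⟩, -1, Or.inr rfl, fun w hw => ?_⟩
    refine (conjLength_le (himage (-1) w hw)).trans_lt ?_
    rw [← hlen w, zpow_neg_one]
    exact raagLength_conj_inv_mul_lt (by rw [hconst w hw]; exact hn)

/-- Pure symmetric automorphisms are products of partial conjugations. -/
theorem PSA_le_pcRep_range [Fintype V] (hΓ : ¬HasSIL Γ) : PSA Γ ≤ (pcRep hΓ).range := by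
  intro φ hφ
  induction hn : ∑ w, conjLength φ w using Nat.strong_induction_on generalizing φ with
  | _ n ih =>
  subst hn
  by_cases h1 : φ = 1
  · rw [h1]
    exact one_mem _
  obtain ⟨p, n, hn, hlt⟩ := exists_pcAut_decreasing hφ h1
  have hmem : pcAut p n ∈ (pcRep hΓ).range := by
    rcases hn with rfl | rfl
    · exact ⟨raagGen _ p, pcRep_gen hΓ p⟩
    · exact ⟨(raagGen _ p)⁻¹, by rw [map_inv, pcRep_gen, pcAut_inv]⟩
  have hsum : ∑ w, conjLength (φ * pcAut p n) w < ∑ w, conjLength φ w := by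
    obtain ⟨w₀, hw₀⟩ := IsCompOf.nonempty p.2
    refine Finset.sum_lt_sum (fun w _ => ?_) ⟨w₀, Finset.mem_univ _, hlt w₀ hw₀⟩
    by_cases hw : w ∈ p.1.2
    · exact (hlt w hw).le
    · rw [conjLength, MulAut.mul_apply, pcAut_of_notMem p n hw, conjLength]
  exact (Subgroup.mul_mem_cancel_right _ hmem).1
    (ih _ hsum (mul_mem hφ (pcAut_mem_PSA p n)) rfl)

end Generation

section Exponents

variable {V : Type} {Γ : SimpleGraph V}

theorem raagGen_induction {H : Subgroup (RAAG Γ)} (h : ∀ v, raagGen Γ v ∈ H) (x : RAAG Γ) :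
    x ∈ H := by
  have : Subgroup.closure (Set.range (raagGen Γ)) ≤ H := by
    refine (Subgroup.closure_le _).2 ?_
    rintro _ ⟨v, rfl⟩
    exact h v
  exact this (closure_range_raagGen (Γ := Γ) ▸ Subgroup.mem_top x)

theorem commute_map_of_gen {G : Type*} [Group G] (f : RAAG Γ →* G)
    (h : ∀ v w, Commute (f (raagGen Γ v)) (f (raagGen Γ w))) (x y : RAAG Γ) :
    Commute (f x) (f y) := by
  have h1 : ∀ v x, Commute (f x) (f (raagGen Γ v)) := fun v x =>
    Subgroup.mem_centralizer_singleton_iff.1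
      (raagGen_induction (H := (Subgroup.centralizer {f (raagGen Γ v)}).comap f)
        (fun w => Subgroup.mem_centralizer_singleton_iff.2 (h w v)) x)
  exact (Subgroup.mem_centralizer_singleton_iff.1
      (raagGen_induction (H := (Subgroup.centralizer {f x}).comap f)
        (fun w => Subgroup.mem_centralizer_singleton_iff.2 (h1 w x).symm) y)).symm

variable (Γ) in
open Classical in
/-- The exponent sum of a generator. -/
noncomputable def expHom (v : V) : RAAG Γ →* Multiplicative ℤ :=
  raagLift (fun w => Multiplicative.ofAdd (if w = v then 1 else 0)) fun _ _ _ => Commute.all _ _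

@[simp]
theorem expHom_self (v : V) : expHom Γ v (raagGen Γ v) = Multiplicative.ofAdd 1 := by
  simp [expHom]

theorem expHom_of_ne {v w : V} (h : w ≠ v) : expHom Γ v (raagGen Γ w) = 1 := by
  simp [expHom, h]

theorem expHom_eq_one_of_mem_closure {v : V} {S : Set V} (h : v ∉ S) {x : RAAG Γ}
    (hx : x ∈ Subgroup.closure (raagGen Γ '' S)) : expHom Γ v x = 1 := by
  have : Subgroup.closure (raagGen Γ '' S) ≤ (expHom Γ v).ker := by
    refine (Subgroup.closure_le _).2 ?_
    rintro _ ⟨w, hw, rfl⟩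
    exact expHom_of_ne fun hwv => h (hwv ▸ hw)
  exact this hx

theorem mem_commutator_of_expHom_eq_one [Finite V] {x : RAAG Γ} (h : ∀ v, expHom Γ v x = 1) :
    x ∈ commutator (RAAG Γ) := by
  classical
  have := Fintype.ofFinite V
  let ψ : RAAG Γ →* Abelianization (RAAG Γ) :=
    ∏ v, (zpowersHom _ (Abelianization.of (raagGen Γ v))).comp (expHom Γ v)
  have hψ : ψ = Abelianization.of := by
    refine raag_hom_ext fun w => ?_
    rw [MonoidHom.finsetProd_apply, Finset.prod_eq_single w]
    · simp
    · intro v _ hv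
      rw [MonoidHom.comp_apply, expHom_of_ne hv.symm, map_one]
    · simp
  rw [← Abelianization.ker_of, MonoidHom.mem_ker, ← hψ, MonoidHom.finsetProd_apply]
  exact Finset.prod_eq_one fun v _ => by rw [MonoidHom.comp_apply, h v, map_one]

open Classical in
/-- The retraction onto a set of generators, killing the other ones. -/
noncomputable def retractTo (U : Set V) : RAAG Γ →* RAAG Γ :=
  raagLift (fun v => if v ∈ U then raagGen Γ v else 1) (by
    intro v w h
    by_cases hv : v ∈ U <;> by_cases hw : w ∈ U <;> simp [hv, hw, raagGen_commute h])

theorem mem_closure_inter {S U : Set V} {x : RAAG Γ}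
    (hS : x ∈ Subgroup.closure (raagGen Γ '' S)) (hU : x ∈ Subgroup.closure (raagGen Γ '' U)) :
    x ∈ Subgroup.closure (raagGen Γ '' (S ∩ U)) := by
  have h1 : Subgroup.closure (raagGen Γ '' U) ≤
      MonoidHom.eqLocus (retractTo U) (MonoidHom.id _) := by
    refine (Subgroup.closure_le _).2 ?_
    rintro _ ⟨w, hw, rfl⟩
    simp [MonoidHom.eqLocus, retractTo, hw]
  have h2 : Subgroup.closure (raagGen Γ '' S) ≤
      (Subgroup.closure (raagGen Γ '' (S ∩ U))).comap (retractTo U) := by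
    refine (Subgroup.closure_le _).2 ?_
    rintro _ ⟨w, hw, rfl⟩
    by_cases hwU : w ∈ U
    · simpa [retractTo, hwU] using Subgroup.subset_closure
        (Set.mem_image_of_mem (raagGen Γ) (show w ∈ S ∩ U from ⟨hw, hwU⟩))
    · simp [retractTo, hwU]
  have := h2 hS
  rw [Subgroup.mem_comap, h1 hU] at this
  exact this

/-- The centre of a right-angled Artin group is generated by the central vertices. -/
theorem mem_closure_Zset_of_mem_center [Fintype V] {x : RAAG Γ}
    (hx : x ∈ Subgroup.center (RAAG Γ)) : x ∈ Subgroup.closure (raagGen Γ '' Zset Γ) := by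
  classical
  have h : ∀ T : Finset V, x ∈ Subgroup.closure (raagGen Γ '' {w | ∀ v ∈ T, w ∈ Gstar Γ v}) := by
    intro T
    induction T using Finset.induction_on with
    | empty =>
      have : {w : V | ∀ v ∈ (∅ : Finset V), w ∈ Gstar Γ v} = Set.univ := by simp
      rw [this, Set.image_univ, closure_range_raagGen]
      trivial
    | insert v T _ ih =>
      have hv : x ∈ starSubgroup Γ v :=
        mem_starSubgroup_iff_commute.2 (Subgroup.mem_center_iff.1 hx _).symm
      refine Subgroup.closure_mono (Set.image_mono ?_) (mem_closure_inter ih hv)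
      rintro w ⟨h1, h2⟩ u hu
      rcases Finset.mem_insert.1 hu with rfl | hu
      · exact h2
      · exact h1 u hu
  refine Subgroup.closure_mono (Set.image_mono fun w hw => ?_) (h Finset.univ)
  exact Set.eq_univ_of_forall fun v => mem_Gstar_comm.1 (hw v (Finset.mem_univ v))

/-- Isomorphic graphs have isomorphic right-angled Artin groups. -/
def raagCongr {W : Type} {Δ : SimpleGraph W} (e : Γ ≃g Δ) : RAAG Γ ≃* RAAG Δ :=
  MonoidHom.toMulEquiv
    (raagLift (fun v => raagGen Δ (e v)) fun _ _ h => raagGen_commute (e.map_adj_iff.2 h))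
    (raagLift (fun w => raagGen Γ (e.symm w)) fun _ _ h =>
      raagGen_commute (e.symm.map_adj_iff.2 h))
    (raag_hom_ext fun v => by simp) (raag_hom_ext fun w => by simp)

end Exponents

section Injectivity

variable {V : Type} {Γ : SimpleGraph V}

theorem pcGen_commute {p q : PCSet Γ} (h : q.1.1 ∉ p.1.2) :
    Commute (raagGen (pcGraph Γ) p) (raagGen (pcGraph Γ) q) := by
  by_cases hpq : p = q
  · rw [hpq]
  · exact raagGen_commute ⟨hpq, fun h' => h h'.1⟩

theorem notMem_of_fst_eq {p q : PCSet Γ} (h : q.1.1 = p.1.1) : q.1.1 ∉ p.1.2 :=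
  h ▸ fst_notMem_snd p

theorem eq_of_fst_eq_of_mem {p q : PCSet Γ} (h : q.1.1 = p.1.1) {v : V} (hp : v ∈ p.1.2)
    (hq : v ∈ q.1.2) : q = p := by
  have hq2 : IsCompOf Γ (Gstar Γ p.1.1)ᶜ q.1.2 := h ▸ q.2
  exact Subtype.ext (Prod.ext h (hq2.eq_of_mem p.2 hq hp))

theorem commute_of_mem_closure_pcGen {x y : RAAG (pcGraph Γ)} {T : Set (PCSet Γ)}
    (hx : x ∈ Subgroup.closure (raagGen (pcGraph Γ) '' T))
    (h : ∀ q ∈ T, Commute (raagGen (pcGraph Γ) q) y) : Commute x y := by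
  have hle : Subgroup.closure (raagGen (pcGraph Γ) '' T) ≤ Subgroup.centralizer {y} := by
    refine (Subgroup.closure_le _).2 ?_
    rintro _ ⟨q, hq, rfl⟩
    exact Subgroup.mem_centralizer_singleton_iff.2 (h q hq)
  exact Subgroup.mem_centralizer_singleton_iff.1 (hle hx)

theorem commute_pcGen_of_mem_closure {p q : PCSet Γ} {r : RAAG (pcGraph Γ)}
    (hr : r ∈ Subgroup.closure (raagGen (pcGraph Γ) '' {q | q.1.1 = p.1.1 ∧ q ≠ p}))
    (hq : q.1.1 ∈ p.1.2) : Commute r (raagGen (pcGraph Γ) q) :=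
  commute_of_mem_closure_pcGen hr fun _ hs =>
    pcGen_commute fun h => hs.2 (eq_of_fst_eq_of_mem hs.1 hq h)

theorem pcRep_eq_of_mem_closure (hΓ : ¬HasSIL Γ) {T : Set (PCSet Γ)} {v : V}
    (hT : ∀ q ∈ T, v ∉ q.1.2) {w : RAAG (pcGraph Γ)}
    (hw : w ∈ Subgroup.closure (raagGen (pcGraph Γ) '' T)) :
    pcRep hΓ w (raagGen Γ v) = raagGen Γ v := by
  have hle : Subgroup.closure (raagGen (pcGraph Γ) '' T) ≤
      (MulAction.stabilizer (MulAut (RAAG Γ)) (raagGen Γ v)).comap (pcRep hΓ) := by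
    refine (Subgroup.closure_le _).2 ?_
    rintro _ ⟨q, hq, rfl⟩
    rw [SetLike.mem_coe, Subgroup.mem_comap, pcRep_gen, MulAction.mem_stabilizer_iff,
      MulAut.smul_def]
    exact pcAut_of_notMem q 1 (hT q hq)
  exact hle hw

theorem expHom_pcRep (hΓ : ¬HasSIL Γ) (w : RAAG (pcGraph Γ)) (a : V) (x : RAAG Γ) :
    expHom Γ a (pcRep hΓ w x) = expHom Γ a x := by
  have h : (expHom Γ a).comp (pcRep hΓ w).toMonoidHom = expHom Γ a :=
    raag_hom_ext fun b =>
      (isConj_iff_eq.1 ((expHom Γ a).map_isConj (pcRep_range_le hΓ ⟨w, rfl⟩ b))).symm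
  exact DFunLike.congr_fun h x

theorem exists_pcAut_conj_expHom_eq {p : PCSet Γ} {b : V} (hb : b ∈ p.1.2) (q : PCSet Γ)
    (n : ℤ) : ∃ g, pcAut q n (raagGen Γ b) = g * raagGen Γ b * g⁻¹ ∧
      expHom Γ p.1.1 g = expHom (pcGraph Γ) p (raagGen _ q) ^ n := by
  by_cases hq : b ∈ q.1.2
  · refine ⟨_, pcAut_of_mem q n hq, ?_⟩
    rw [map_zpow]
    by_cases h : q.1.1 = p.1.1
    · rw [eq_of_fst_eq_of_mem h hb hq, expHom_self, expHom_self]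
    · rw [expHom_of_ne h, expHom_of_ne fun h' : q = p => h (by rw [h'])]
  · refine ⟨1, by rw [pcAut_of_notMem q n hq]; simp, ?_⟩
    rw [expHom_of_ne fun h : q = p => hq (by rw [h]; exact hb), map_one, one_zpow]

theorem exists_conj_expHom_eq (hΓ : ¬HasSIL Γ) (p : PCSet Γ) {b : V} (hb : b ∈ p.1.2)
    (w : RAAG (pcGraph Γ)) :
    ∃ g, pcRep hΓ w (raagGen Γ b) = g * raagGen Γ b * g⁻¹ ∧
      expHom Γ p.1.1 g = expHom (pcGraph Γ) p w := by
  have step : ∀ w q, ∀ n : ℤ, (∃ g, pcRep hΓ w (raagGen Γ b) = g * raagGen Γ b * g⁻¹ ∧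
      expHom Γ p.1.1 g = expHom (pcGraph Γ) p w) →
      ∃ g, (pcRep hΓ w * pcAut q n) (raagGen Γ b) = g * raagGen Γ b * g⁻¹ ∧
        expHom Γ p.1.1 g =
          expHom (pcGraph Γ) p w * expHom (pcGraph Γ) p (raagGen _ q) ^ n := by
    rintro w q n ⟨g, hg, he⟩
    obtain ⟨g', hg', he'⟩ := exists_pcAut_conj_expHom_eq hb q n
    refine ⟨pcRep hΓ w g' * g, ?_, ?_⟩
    · rw [MulAut.mul_apply, hg', map_mul, map_mul, map_inv, hg]
      group
    · rw [map_mul, expHom_pcRep, he, he', mul_comm]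
  induction w using raag_induction_right with
  | h1 => exact ⟨1, by simp, by simp⟩
  | hmul w q ih => simpa using step w q 1 ih
  | hinv w q ih => simpa [← pcAut_inv] using step w q (-1) ih

variable [Fintype V]

open Classical in
/-- The partial conjugations with a given acting letter. -/
noncomputable def pcsOf (Γ : SimpleGraph V) (a : V) : Finset (PCSet Γ) :=
  (Set.toFinite {p : PCSet Γ | p.1.1 = a}).toFinset

theorem mem_pcsOf {a : V} {p : PCSet Γ} : p ∈ pcsOf Γ a ↔ p.1.1 = a := by
  simp [pcsOf]

theorem pcsOf_pairwise (a : V) : (pcsOf Γ a : Set (PCSet Γ)).Pairwise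
    (Function.onFun Commute (raagGen (pcGraph Γ))) := fun _ hp _ hq _ =>
  pcGen_commute (notMem_of_fst_eq ((mem_pcsOf.1 hq).trans (mem_pcsOf.1 hp).symm))

variable (Γ) in
/-- The product of all partial conjugations with a given acting letter. -/
noncomputable def pcProd (a : V) : RAAG (pcGraph Γ) :=
  (pcsOf Γ a).noncommProd (raagGen (pcGraph Γ)) (pcsOf_pairwise a)

theorem commute_pcProd {x : RAAG (pcGraph Γ)} {a : V}
    (h : ∀ q : PCSet Γ, q.1.1 = a → Commute x (raagGen (pcGraph Γ) q)) :
    Commute x (pcProd Γ a) :=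
  Finset.noncommProd_commute _ _ _ _ fun q hq => h q (mem_pcsOf.1 hq)

/-- The inner automorphisms, expressed through partial conjugations. -/
noncomputable def innerHom (Γ : SimpleGraph V) : RAAG Γ →* RAAG (pcGraph Γ) :=
  raagLift (pcProd Γ) (by
    intro a b hab
    refine commute_pcProd fun q hq => (commute_pcProd fun p hp => ?_).symm
    refine (pcGen_commute fun h => ?_).symm
    refine IsCompOf.subset p.2 h (Or.inr ?_)
    rw [hp, hq]
    exact hab)

@[simp]
theorem innerHom_gen (a : V) : innerHom Γ (raagGen Γ a) = pcProd Γ a :=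
  raagLift_gen _ _ a

theorem pcProd_mem_closure (a : V) :
    pcProd Γ a ∈ Subgroup.closure (raagGen (pcGraph Γ) '' {q | q.1.1 = a}) :=
  Subgroup.noncommProd_mem _ _ fun _ hq =>
    Subgroup.subset_closure (Set.mem_image_of_mem _ (mem_pcsOf.1 hq))

open Classical in
theorem exists_pcProd_eq (p : PCSet Γ) :
    ∃ r ∈ Subgroup.closure (raagGen (pcGraph Γ) '' {q | q.1.1 = p.1.1 ∧ q ≠ p}),
      pcProd Γ p.1.1 = raagGen _ p * r := by
  refine ⟨((pcsOf Γ p.1.1).erase p).noncommProd (raagGen (pcGraph Γ))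
    ((pcsOf_pairwise p.1.1).mono (Finset.coe_subset.2 (Finset.erase_subset _ _))), ?_, ?_⟩
  · refine Subgroup.noncommProd_mem _ _ fun q hq => Subgroup.subset_closure
      (Set.mem_image_of_mem _ ?_)
    rw [Finset.mem_erase, mem_pcsOf] at hq
    exact ⟨hq.2, hq.1⟩
  · exact (Finset.mul_noncommProd_erase _ (mem_pcsOf.2 rfl) _ _).symm

theorem conj_innerHom_gen (p : PCSet Γ) (x : RAAG Γ) :
    raagGen _ p * innerHom Γ x * (raagGen _ p)⁻¹ = innerHom Γ (pcAut p 1 x) := by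
  have h : (MulAut.conj (raagGen (pcGraph Γ) p)).toMonoidHom.comp (innerHom Γ) =
      (innerHom Γ).comp (pcAut p 1).toMonoidHom := by
    refine raag_hom_ext fun b => ?_
    simp only [MonoidHom.comp_apply, MulEquiv.coe_toMonoidHom, MulAut.conj_apply, innerHom_gen]
    by_cases hb : b ∈ p.1.2
    · obtain ⟨r, hmem, hr⟩ := exists_pcProd_eq p
      have hc : Commute r (pcProd Γ b) := commute_pcProd fun q hq =>
        commute_pcGen_of_mem_closure hmem (hq ▸ hb)
      rw [pcAut_of_mem p 1 hb]
      simp only [map_mul, map_inv, zpow_one, innerHom_gen, hr]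
      have := hc.eq
      calc _ = raagGen _ p * (pcProd Γ b * r) * r⁻¹ * (raagGen _ p)⁻¹ := by group
        _ = _ := by rw [← this]; group
    · rw [pcAut_of_notMem p 1 hb, innerHom_gen, mul_inv_eq_iff_eq_mul]
      exact (commute_pcProd fun q hq => pcGen_commute (hq ▸ hb)).eq
  exact DFunLike.congr_fun h x

theorem conj_innerHom (hΓ : ¬HasSIL Γ) (w : RAAG (pcGraph Γ)) (x : RAAG Γ) :
    w * innerHom Γ x * w⁻¹ = innerHom Γ (pcRep hΓ w x) := by
  induction w using raag_induction_right generalizing x with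
  | h1 => simp
  | hmul w p ih =>
    rw [map_mul, MulAut.mul_apply, ← ih, pcRep_gen, ← conj_innerHom_gen]
    group
  | hinv w p ih =>
    rw [map_mul, MulAut.mul_apply, ← ih, map_inv, pcRep_gen]
    have := conj_innerHom_gen p ((pcAut p 1)⁻¹ x)
    rw [MulAut.apply_inv_self] at this
    rw [← this]
    group

theorem innerHom_range_normal (hΓ : ¬HasSIL Γ) : (innerHom Γ).range.Normal :=
  ⟨by
    rintro _ ⟨x, rfl⟩ w
    exact ⟨_, (conj_innerHom hΓ w x).symm⟩⟩

theorem commutator_le_innerHom_range (hΓ : ¬HasSIL Γ) :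
    commutator (RAAG (pcGraph Γ)) ≤ (innerHom Γ).range := by
  have := innerHom_range_normal hΓ
  have hcomm := commute_map_of_gen (QuotientGroup.mk' (innerHom Γ).range) (by
    intro p q
    by_cases h : q.1.1 ∈ p.1.2
    · obtain ⟨r, hmem, hr⟩ := exists_pcProd_eq p
      have h1 : (QuotientGroup.mk' (innerHom Γ).range) (raagGen _ p * r) = 1 := by
        rw [← MonoidHom.mem_ker, QuotientGroup.ker_mk', ← hr, ← innerHom_gen]
        exact ⟨_, rfl⟩
      rw [map_mul, mul_eq_one_iff_eq_inv] at h1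
      rw [h1]
      exact ((commute_pcGen_of_mem_closure hmem h).map _).inv_left
    · exact (pcGen_commute h).map _)
  rw [commutator_def, Subgroup.commutator_le]
  intro x _ y _
  rw [← QuotientGroup.ker_mk' (innerHom Γ).range, MonoidHom.mem_ker, map_commutatorElement,
    commutatorElement_eq_one_iff_commute]
  exact hcomm x y

theorem pcRep_innerHom (hΓ : ¬HasSIL Γ) (x : RAAG Γ) :
    pcRep hΓ (innerHom Γ x) = MulAut.conj x := by
  have h : (pcRep hΓ).comp (innerHom Γ) = MulAut.conj := by
    refine raag_hom_ext fun a => raag_aut_ext fun v => ?_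
    rw [MonoidHom.comp_apply, innerHom_gen, MulAut.conj_apply]
    by_cases hv : v ∈ Gstar Γ a
    · rw [pcRep_eq_of_mem_closure hΓ (fun q hq h => ?_) (pcProd_mem_closure a),
        (raagGen_commute_of_mem_Gstar hv).eq, mul_inv_cancel_right]
      exact IsCompOf.subset q.2 h (hq ▸ hv)
    · obtain ⟨K, hK, hvK⟩ := exists_isCompOf_mem (Γ := Γ) (S := (Gstar Γ a)ᶜ) hv
      let p : PCSet Γ := ⟨(a, K), hK⟩
      obtain ⟨r, hmem, hr⟩ := exists_pcProd_eq p
      rw [show pcProd Γ a = _ from hr, map_mul, MulAut.mul_apply, pcRep_eq_of_mem_closure hΓ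
        (fun q hq h => hq.2 (eq_of_fst_eq_of_mem hq.1 hvK h)) hmem, pcRep_gen,
        pcAut_of_mem p 1 hvK, zpow_one]
  exact DFunLike.congr_fun h x

theorem pcRep_injective (hΓ : ¬HasSIL Γ) : Function.Injective (pcRep hΓ) := by
  rw [injective_iff_map_eq_one]
  intro w hw
  have hexp : ∀ p, expHom (pcGraph Γ) p w = 1 := by
    intro p
    obtain ⟨b, hb⟩ := IsCompOf.nonempty p.2
    obtain ⟨g, hg, he⟩ := exists_conj_expHom_eq hΓ p hb w
    rw [hw, MulAut.one_apply, eq_mul_inv_iff_mul_eq] at hg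
    rw [← he]
    refine expHom_eq_one_of_mem_closure ?_ (mem_starSubgroup_iff_commute.2 hg.symm)
    exact fun h => IsCompOf.subset p.2 hb (mem_Gstar_comm.1 h)
  obtain ⟨x, rfl⟩ := commutator_le_innerHom_range hΓ (mem_commutator_of_expHom_eq_one hexp)
  rw [pcRep_innerHom] at hw
  have hx : x ∈ Subgroup.center (RAAG Γ) := Subgroup.mem_center_iff.2 fun y => by
    have := DFunLike.congr_fun hw y
    rw [MulAut.conj_apply, MulAut.one_apply, mul_inv_eq_iff_eq_mul] at this
    exact this.symm
  have hle : Subgroup.closure (raagGen Γ '' Zset Γ) ≤ (innerHom Γ).ker := by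
    refine (Subgroup.closure_le _).2 ?_
    rintro _ ⟨z, hz, rfl⟩
    have : pcsOf Γ z = ∅ := Finset.eq_empty_of_forall_notMem fun p hp => by
      obtain ⟨b, hb⟩ := IsCompOf.nonempty p.2
      refine IsCompOf.subset p.2 hb ?_
      rw [mem_pcsOf.1 hp, show Gstar Γ z = Set.univ from hz]
      trivial
    rw [SetLike.mem_coe, MonoidHom.mem_ker, innerHom_gen, pcProd]
    simp only [this]
    exact Finset.noncommProd_empty _ _
  exact hle (mem_closure_Zset_of_mem_center hx)

end Injectivity

/-- Charney–Ruane–Stambaugh–Vijayan. If `Γ` contains no SIL, then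
`PΣ(A(Γ))` is isomorphic to a right-angled Artin group. -/
theorem psa_raag_of_no_sil {V : Type} [Fintype V] (Γ : SimpleGraph V) (h : ¬HasSIL Γ) :
    ∃ (n : ℕ) (Δ : SimpleGraph (Fin n)), Nonempty (↥(PSA Γ) ≃* RAAG Δ) := by
  have e : PSA Γ ≃* RAAG (pcGraph Γ) :=
    (MulEquiv.subgroupCongr (le_antisymm (PSA_le_pcRep_range h) (pcRep_range_le h))).trans
      (MonoidHom.ofInjective (pcRep_injective h)).symm
  obtain ⟨n, ⟨f⟩⟩ := Finite.exists_equiv_fin (PCSet Γ)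
  exact ⟨n, _, ⟨e.trans (raagCongr (SimpleGraph.Iso.map f (pcGraph Γ)))⟩⟩
end

section
/- Let Γ be a finite simplicial graph with vertex set V and let A = A(Γ). Then the pure symmetric automorphism group PΣ(A) is generated by the set 𝒫 of partial conjugations; that is, PΣ(A) equals the subgroup of Aut(A) generated by {π_{a,K} : a ∈ V, st(a) ≠ V, K a connected component of Γ∖st(a)}. -/
open SimpleGraph

namespace RAAG

variable {V : Type} {Γ : SimpleGraph V}

theorem gen_comm {a b : V} (h : Γ.Adj a b) :
    raagGen Γ a * raagGen Γ b = raagGen Γ b * raagGen Γ a := by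
  have h1 : (PresentedGroup.mk (raagRels Γ)) (FreeGroup.of a * FreeGroup.of b *
      (FreeGroup.of a)⁻¹ * (FreeGroup.of b)⁻¹) = 1 :=
    PresentedGroup.one_of_mem ⟨a, b, h, rfl⟩
  simp only [map_mul, map_inv] at h1
  rw [mul_inv_eq_one, mul_inv_eq_iff_eq_mul] at h1
  exact h1

/-- The homomorphism out of `A(Γ)` determined by images of the generators that commute whenever
the corresponding vertices are adjacent. -/
noncomputable def lift {G : Type*} [Group G] (f : V → G)
    (hf : ∀ a b, Γ.Adj a b → f a * f b = f b * f a) : RAAG Γ →* G :=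
  PresentedGroup.toGroup (f := f) (by
    rintro r ⟨a, b, hab, rfl⟩
    simp only [map_mul, map_inv, FreeGroup.lift_apply_of]
    rw [mul_inv_eq_one, mul_inv_eq_iff_eq_mul]
    exact hf a b hab)

@[simp] theorem lift_gen {G : Type*} [Group G] (f : V → G)
    (hf : ∀ a b, Γ.Adj a b → f a * f b = f b * f a) (v : V) :
    lift f hf (raagGen Γ v) = f v :=
  PresentedGroup.toGroup.of _

theorem hom_ext {G : Type*} [Group G] {f g : RAAG Γ →* G}
    (h : ∀ v, f (raagGen Γ v) = g (raagGen Γ v)) : f = g :=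
  PresentedGroup.ext h

/-- The letter `v` or `v⁻¹`. -/
def letter (Γ : SimpleGraph V) (p : V × Bool) : RAAG Γ :=
  if p.2 then raagGen Γ p.1 else (raagGen Γ p.1)⁻¹

/-- The element of `A(Γ)` represented by a word. -/
def wordProd (Γ : SimpleGraph V) (L : List (V × Bool)) : RAAG Γ :=
  (L.map (letter Γ)).prod

@[simp] theorem wordProd_nil : wordProd Γ [] = 1 := rfl

@[simp] theorem wordProd_cons (p : V × Bool) (L : List (V × Bool)) :
    wordProd Γ (p :: L) = letter Γ p * wordProd Γ L := by
  simp [wordProd]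

theorem wordProd_append (L M : List (V × Bool)) :
    wordProd Γ (L ++ M) = wordProd Γ L * wordProd Γ M := by
  simp [wordProd]

theorem exists_word (g : RAAG Γ) : ∃ L, wordProd Γ L = g := by
  obtain ⟨w, rfl⟩ := PresentedGroup.mk_surjective (raagRels Γ) g
  induction w using FreeGroup.induction_on with
  | C1 => exact ⟨[], by simp⟩
  | of x => exact ⟨[(x, true)], by simp [letter, raagGen, PresentedGroup.of]⟩
  | inv_of x _ => exact ⟨[(x, false)], by simp [letter, raagGen, PresentedGroup.of]⟩
  | mul x y hx hy =>
    obtain ⟨L, hL⟩ := hx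
    obtain ⟨M, hM⟩ := hy
    exact ⟨L ++ M, by rw [wordProd_append, hL, hM, map_mul]⟩

/-- Conjugate generators are equal. -/
theorem eq_of_conj {v w : V} {g h : RAAG Γ}
    (e : g * raagGen Γ v * g⁻¹ = h * raagGen Γ w * h⁻¹) : v = w := by
  classical
  let χ : RAAG Γ →* Multiplicative ℤ :=
    lift (fun u => Multiplicative.ofAdd (if u = v then (1 : ℤ) else 0)) (fun _ _ _ => mul_comm _ _)
  have := congrArg χ e
  simp only [map_mul, map_inv, mul_inv_cancel_comm, χ, lift_gen, if_true] at this
  by_contra hne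
  rw [if_neg (Ne.symm hne)] at this
  exact absurd (Multiplicative.ofAdd.injective this) one_ne_zero

open Classical in
/-- The permutation `(t, n) ↦ (x t x⁻¹, n + [t = x])`. -/
noncomputable def shift {G : Type*} [Group G] (x : G) : Equiv.Perm (G × ℤ) where
  toFun q := (x * q.1 * x⁻¹, q.2 + if q.1 = x then 1 else 0)
  invFun q := (x⁻¹ * q.1 * x, q.2 - if q.1 = x then 1 else 0)
  left_inv q := by
    have : x * q.1 * x⁻¹ = x ↔ q.1 = x := by
      rw [mul_inv_eq_iff_eq_mul, mul_right_inj]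
    refine Prod.ext (by simp only; group) ?_
    simp only [this, add_sub_cancel_right]
  right_inv q := by
    have : x⁻¹ * q.1 * x = x ↔ q.1 = x := by
      rw [mul_assoc, inv_mul_eq_iff_eq_mul, mul_left_inj]
    refine Prod.ext (by simp only; group) ?_
    simp only [this, sub_add_cancel]

theorem shift_comm {G : Type*} [Group G] {x y : G} (h : x * y = y * x) :
    shift x * shift y = shift y * shift x := by
  classical
  have h1 : ∀ {x y : G}, x * y = y * x → ∀ t, y * t * y⁻¹ = x ↔ t = x := by
    intro x y h t
    rw [mul_inv_eq_iff_eq_mul, h, mul_right_inj]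
  ext q
  · simp only [shift, Equiv.Perm.mul_apply, Equiv.coe_fn_mk]
    rw [show x * (y * q.1 * y⁻¹) * x⁻¹ = (x * y) * q.1 * (x * y)⁻¹ by group, h]
    group
  · simp only [shift, Equiv.Perm.mul_apply, Equiv.coe_fn_mk]
    rw [if_congr (h1 h q.1) rfl rfl, if_congr (h1 h.symm q.1) rfl rfl]
    ring

/-- The action of `A(Γ)` on `A(Γ) × ℤ` which records crossings of walls. -/
noncomputable def wallAction (Γ : SimpleGraph V) : RAAG Γ →* Equiv.Perm (RAAG Γ × ℤ) :=
  lift (fun v => shift (raagGen Γ v)) (fun _ _ h => shift_comm (gen_comm h))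

/-- The signed number of times a path from `1` to `g` in the Cayley graph crosses the wall
of `t`. -/
noncomputable def crossing (g t : RAAG Γ) : ℤ := -(wallAction Γ g⁻¹ (t, 0)).2

open Classical in
theorem wallAction_letter_inv (p : V × Bool) (t : RAAG Γ) (n : ℤ) :
    wallAction Γ (letter Γ p)⁻¹ (t, n) = ((letter Γ p)⁻¹ * t * letter Γ p,
      n - if t = raagGen Γ p.1 then (if p.2 then 1 else -1) else 0) := by
  obtain ⟨v, b⟩ := p
  cases b
  · simp only [letter, wallAction, Bool.false_eq_true, if_false, inv_inv, lift_gen]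
    refine Prod.ext rfl ?_
    simp only [shift, Equiv.coe_fn_mk]
    split_ifs <;> ring
  · simp only [letter, wallAction, if_true, map_inv, lift_gen]
    rfl

theorem wallAction_inv_apply (g t : RAAG Γ) (n : ℤ) :
    wallAction Γ g⁻¹ (t, n) = (g⁻¹ * t * g, n - crossing g t) := by
  classical
  obtain ⟨L, rfl⟩ := exists_word g
  induction L generalizing t n with
  | nil => simp [crossing]
  | cons p L ih =>
    rw [crossing, wordProd_cons, mul_inv_rev, map_mul, Equiv.Perm.mul_apply,
      Equiv.Perm.mul_apply, wallAction_letter_inv, wallAction_letter_inv, ih, ih]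
    refine Prod.ext ?_ ?_
    · simp only; group
    · simp only; ring

theorem crossing_mul (g h t : RAAG Γ) :
    crossing (g * h) t = crossing g t + crossing h (g⁻¹ * t * g) := by
  conv_lhs => rw [crossing, mul_inv_rev, map_mul, Equiv.Perm.mul_apply, wallAction_inv_apply,
    wallAction_inv_apply]
  ring

@[simp] theorem crossing_one (t : RAAG Γ) : crossing 1 t = 0 := by
  simp [crossing]

theorem crossing_inv (g t : RAAG Γ) : crossing g⁻¹ t = -crossing g (g * t * g⁻¹) := by
  have := crossing_mul g g⁻¹ (g * t * g⁻¹)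
  rw [mul_inv_cancel, crossing_one, show g⁻¹ * (g * t * g⁻¹) * g = t by group] at this
  omega

open Classical in
theorem crossing_letter (p : V × Bool) (t : RAAG Γ) :
    crossing (letter Γ p) t = if t = raagGen Γ p.1 then (if p.2 then 1 else -1) else 0 := by
  rw [crossing, wallAction_letter_inv]
  simp

open Classical in
theorem crossing_gen (v : V) (t : RAAG Γ) :
    crossing (raagGen Γ v) t = if t = raagGen Γ v then 1 else 0 := by
  simpa [letter] using crossing_letter (v, true) t

theorem crossing_conj (g x t : RAAG Γ) :
    crossing (g * x * g⁻¹) t = crossing g t + crossing x (g⁻¹ * t * g) -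
      crossing g ((g * x * g⁻¹)⁻¹ * t * (g * x * g⁻¹)) := by
  rw [crossing_mul, crossing_mul, crossing_inv]
  rw [show g * ((g * x)⁻¹ * t * (g * x)) * g⁻¹ = (g * x * g⁻¹)⁻¹ * t * (g * x * g⁻¹) by group]
  ring

theorem finite_crossing (g : RAAG Γ) : {t | crossing g t ≠ 0}.Finite := by
  classical
  obtain ⟨L, rfl⟩ := exists_word g
  induction L with
  | nil => simp
  | cons p L ih =>
    refine ((Set.finite_singleton (raagGen Γ p.1)).union
      (ih.image fun t => letter Γ p * t * (letter Γ p)⁻¹)).subset ?_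
    intro t ht
    rw [Set.mem_ofPred_eq, wordProd_cons, crossing_mul, crossing_letter] at ht
    by_cases h : t = raagGen Γ p.1
    · exact Or.inl h
    · rw [if_neg h, zero_add] at ht
      exact Or.inr ⟨_, ht, by group⟩

/-- Reflecting a word across a wall it crosses shortens it. -/
theorem exists_shorter_word (b : Bool) (L : List (V × Bool)) (t : RAAG Γ)
    (h : 0 < (if b then crossing (wordProd Γ L) t else -crossing (wordProd Γ L) t)) :
    ∃ M : List (V × Bool), M.length < L.length ∧
      wordProd Γ M = (if b then t⁻¹ else t) * wordProd Γ L := by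
  classical
  induction L generalizing t with
  | nil => simp at h
  | cons p L ih =>
    rw [wordProd_cons, crossing_mul, crossing_letter] at h
    by_cases hp : t = raagGen Γ p.1 ∧ p.2 = b
    · refine ⟨L, by simp, ?_⟩
      obtain ⟨v, c⟩ := p
      obtain ⟨rfl, rfl⟩ := hp
      cases c <;> simp [letter]
    · obtain ⟨M, hM, e⟩ := ih ((letter Γ p)⁻¹ * t * letter Γ p) (by
        revert h
        obtain ⟨v, c⟩ := p
        cases b <;> cases c <;> simp at hp ⊢ <;> split_ifs <;> intro h <;> omega)
      refine ⟨p :: M, by simpa using hM, ?_⟩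
      rw [wordProd_cons, wordProd_cons, e]
      cases b
      · simp only [Bool.false_eq_true, if_false]; group
      · simp only [if_true]; group

/-- A word whose first letter is cancelled later on can be shortened. -/
theorem exists_shorter_word_of_crossing_eq_zero {p : V × Bool} {L : List (V × Bool)}
    (h1 : crossing (wordProd Γ (p :: L)) (raagGen Γ p.1) = 0) :
    ∃ M : List (V × Bool), M.length < L.length ∧ wordProd Γ M = wordProd Γ (p :: L) := by
  classical
  rw [wordProd_cons, crossing_mul, crossing_letter, if_pos rfl] at h1
  have e : (letter Γ p)⁻¹ * raagGen Γ p.1 * letter Γ p = raagGen Γ p.1 := by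
    unfold letter; split_ifs <;> group
  rw [e] at h1
  obtain ⟨M, hM, e'⟩ := exists_shorter_word (!p.2) L (raagGen Γ p.1) (by
    revert h1; cases p.2 <;> simp <;> omega)
  have e2 : wordProd Γ M = wordProd Γ (p :: L) := by
    rw [e', wordProd_cons]; unfold letter; cases p.2 <;> simp
  exact ⟨M, hM, e2⟩

/-- `A(Γ)` acts on `ℚ` by affine maps, with `v` a translation and `w` a dilation, when `v` and `w`
are distinct and not adjacent. -/
theorem exists_affine (v w : V) (hvw : v ≠ w) (hadj : ¬ Γ.Adj v w) :
    ∃ θ : RAAG Γ →* Equiv.Perm ℚ, (∀ x, θ (raagGen Γ v) x = x + 1) ∧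
      (∀ x, θ (raagGen Γ w) x = 2 * x) ∧
      ∀ g, ∃ a : ℚ, a ≠ 0 ∧ ∀ x y, θ g (x + y) = θ g x + a * y := by
  classical
  let f : V → Equiv.Perm ℚ := fun u => if u = v then Equiv.addRight 1 else
    if u = w then Equiv.mulLeft₀ 2 two_ne_zero else 1
  have hf : ∀ a b, Γ.Adj a b → f a * f b = f b * f a := by
    intro a b hab
    by_cases ha : a = v ∨ a = w
    · by_cases hb : b = v ∨ b = w
      · rcases ha with rfl | rfl <;> rcases hb with rfl | rfl
        · rfl
        · exact absurd hab hadj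
        · exact absurd hab.symm hadj
        · rfl
      · rw [not_or] at hb
        simp [f, hb.1, hb.2]
    · rw [not_or] at ha
      simp [f, ha.1, ha.2]
  refine ⟨lift f hf, by simp [f], by simp [f, hvw.symm], fun g => ?_⟩
  have hlet : ∀ p : V × Bool, ∃ a : ℚ, a ≠ 0 ∧ ∀ x y, lift f hf (letter Γ p) (x + y) =
      lift f hf (letter Γ p) x + a * y := by
    rintro ⟨u, b⟩
    by_cases hu : u = v
    · refine ⟨1, one_ne_zero, fun x y => ?_⟩
      cases b <;> simp [letter, f, hu] <;> ring
    · by_cases hw : u = w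
      · cases b
        · refine ⟨2⁻¹, by norm_num, fun x y => ?_⟩
          have : ∀ z : ℚ, (Equiv.mulLeft₀ (2 : ℚ) two_ne_zero)⁻¹ z = 2⁻¹ * z := fun z => rfl
          simp [letter, f, hw, hvw.symm]; ring
        · refine ⟨2, two_ne_zero, fun x y => ?_⟩
          simp [letter, f, hw, hvw.symm]; ring
      · refine ⟨1, one_ne_zero, fun x y => ?_⟩
        cases b <;> simp [letter, f, hu, hw]
  obtain ⟨L, rfl⟩ := exists_word g
  induction L with
  | nil => exact ⟨1, one_ne_zero, by simp⟩
  | cons p L ih =>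
    obtain ⟨a, ha, h⟩ := ih
    obtain ⟨c, hc, h'⟩ := hlet p
    refine ⟨c * a, mul_ne_zero hc ha, fun x y => ?_⟩
    rw [wordProd_cons, map_mul, Equiv.Perm.mul_apply, Equiv.Perm.mul_apply, h, h', mul_assoc]

/-- No positive power of a conjugate of `w` commutes with a conjugate of `v` when `v` and `w` are
distinct and not adjacent. -/
theorem not_commute_conj_pow {v w : V} (hvw : v ≠ w) (hadj : ¬ Γ.Adj v w) (g k : RAAG Γ) {d : ℕ}
    (hd : d ≠ 0) :
    (g * raagGen Γ w * g⁻¹) ^ d * (k * raagGen Γ v * k⁻¹) ≠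
      (k * raagGen Γ v * k⁻¹) * (g * raagGen Γ w * g⁻¹) ^ d := by
  intro e
  obtain ⟨θ, hv, hw, hθ⟩ := exists_affine v w hvw hadj
  have e' : raagGen Γ w ^ d * ((g⁻¹ * k) * raagGen Γ v * (g⁻¹ * k)⁻¹) =
      ((g⁻¹ * k) * raagGen Γ v * (g⁻¹ * k)⁻¹) * raagGen Γ w ^ d := by
    rw [conj_pow] at e
    have := congrArg (fun z => g⁻¹ * z * g) e
    simpa [mul_assoc] using this
  obtain ⟨a, ha, h⟩ := hθ (g⁻¹ * k)
  have hpow : ∀ x, θ (raagGen Γ w ^ d) x = 2 ^ d * x := by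
    intro x
    clear hd e e'
    induction d with
    | zero => simp
    | succ d ih => rw [pow_succ', map_mul, Equiv.Perm.mul_apply, ih, hw]; ring
  have ht : ∀ x, θ ((g⁻¹ * k) * raagGen Γ v * (g⁻¹ * k)⁻¹) x = x + a := by
    intro x
    rw [map_mul, map_mul, Equiv.Perm.mul_apply, Equiv.Perm.mul_apply, hv, h, map_inv,
      ← Equiv.Perm.mul_apply, mul_inv_cancel, Equiv.Perm.one_apply, mul_one]
  have := congrArg (fun z => θ z 0) e'
  simp only [map_mul θ (raagGen Γ w ^ d), map_mul θ _ (raagGen Γ w ^ d),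
    Equiv.Perm.mul_apply, ht, hpow] at this
  have h2 : (2 : ℚ) ^ d ≠ 1 := (one_lt_pow₀ one_lt_two hd).ne'
  apply h2
  apply mul_right_cancel₀ ha
  linarith

theorem eventually_crossing_eq_zero {v w : V} (hvw : v ≠ w) (hadj : ¬ Γ.Adj v w)
    (g k h : RAAG Γ) :
    ∀ᶠ n : ℕ in Filter.atTop, crossing h (((g * raagGen Γ w * g⁻¹) ^ n)⁻¹ *
      (k * raagGen Γ v * k⁻¹) * (g * raagGen Γ w * g⁻¹) ^ n) = 0 := by
  set s := g * raagGen Γ w * g⁻¹ with hs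
  set t := k * raagGen Γ v * k⁻¹ with ht
  have hinj : Function.Injective fun n : ℕ => (s ^ n)⁻¹ * t * s ^ n := by
    refine Function.Injective.of_lt_imp_ne fun m n hmn e => ?_
    obtain ⟨d, rfl⟩ := Nat.exists_eq_add_of_lt hmn
    apply not_commute_conj_pow hvw hadj g k (Nat.succ_ne_zero d)
    rw [← hs, ← ht]
    have e1 : (s ^ m)⁻¹ * t * s ^ m = (s ^ m)⁻¹ * ((s ^ (d + 1))⁻¹ * t * s ^ (d + 1)) * s ^ m := by
      have e2 : (s ^ m)⁻¹ * t * s ^ m = (s ^ (m + d + 1))⁻¹ * t * s ^ (m + d + 1) := e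
      rw [e2, show m + d + 1 = (d + 1) + m by ring, pow_add s (d + 1) m]
      group
    rw [mul_left_inj, mul_right_inj] at e1
    calc s ^ (d + 1) * t = s ^ (d + 1) * ((s ^ (d + 1))⁻¹ * t * s ^ (d + 1)) := by rw [← e1]
      _ = t * s ^ (d + 1) := by group
  have := hinj.tendsto_cofinite.eventually (finite_crossing h).eventually_cofinite_notMem
  rw [Nat.cofinite_eq_atTop] at this
  exact this.mono fun n hn => by simpa using hn

theorem crossing_gen_pow {v w : V} (hvw : v ≠ w) (k : RAAG Γ) (n : ℕ) :
    crossing (raagGen Γ w ^ n) (k * raagGen Γ v * k⁻¹) = 0 := by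
  classical
  induction n generalizing k with
  | zero => simp
  | succ n ih =>
    rw [pow_succ', crossing_mul, crossing_gen, if_neg, zero_add,
      show (raagGen Γ w)⁻¹ * (k * raagGen Γ v * k⁻¹) * raagGen Γ w =
        ((raagGen Γ w)⁻¹ * k) * raagGen Γ v * ((raagGen Γ w)⁻¹ * k)⁻¹ by group, ih]
    intro e
    exact hvw (eq_of_conj (g := k) (h := 1) (by simpa using e))

theorem crossing_conj_pow {v w : V} (hvw : v ≠ w) (g k : RAAG Γ) (n : ℕ) :
    crossing ((g * raagGen Γ w * g⁻¹) ^ n) (k * raagGen Γ v * k⁻¹) =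
      crossing g (k * raagGen Γ v * k⁻¹) - crossing g (((g * raagGen Γ w * g⁻¹) ^ n)⁻¹ *
      (k * raagGen Γ v * k⁻¹) * (g * raagGen Γ w * g⁻¹) ^ n) := by
  rw [conj_pow, crossing_conj,
    show g⁻¹ * (k * raagGen Γ v * k⁻¹) * g = (g⁻¹ * k) * raagGen Γ v * (g⁻¹ * k)⁻¹ by group,
    crossing_gen_pow hvw, add_zero]

/-- Walls which intersect each other lie on the same side of any wall which they both miss. -/
theorem crossing_eq_of_commute {v u w : V} (hvu : v ≠ u) (hau : ¬ Γ.Adj v u) (hvw : v ≠ w)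
    (haw : ¬ Γ.Adj v w) {g h k : RAAG Γ}
    (hc : (g * raagGen Γ u * g⁻¹) * (h * raagGen Γ w * h⁻¹) =
      (h * raagGen Γ w * h⁻¹) * (g * raagGen Γ u * g⁻¹)) :
    crossing g (k * raagGen Γ v * k⁻¹) = crossing h (k * raagGen Γ v * k⁻¹) := by
  set s := g * raagGen Γ u * g⁻¹ with hs
  set r := h * raagGen Γ w * h⁻¹ with hr
  obtain ⟨m, hm1, hm2⟩ := ((eventually_crossing_eq_zero hvu hau g k g).and
    (eventually_crossing_eq_zero hvu hau g k h)).exists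
  rw [← hs] at hm1 hm2
  have hcm : ∀ n, s ^ m * r ^ n = r ^ n * s ^ m := fun n =>
    ((show Commute s r from hc).pow_pow m n).eq
  have conjk : ∀ x : RAAG Γ, x⁻¹ * (k * raagGen Γ v * k⁻¹) * x =
      (x⁻¹ * k) * raagGen Γ v * (x⁻¹ * k)⁻¹ := fun x => by group
  obtain ⟨n, ⟨hn1, hn2⟩, hn3, hn4⟩ := (((eventually_crossing_eq_zero hvw haw h k g).and
    (eventually_crossing_eq_zero hvw haw h k h)).and
    ((eventually_crossing_eq_zero hvw haw h ((s ^ m)⁻¹ * k) g).and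
    (eventually_crossing_eq_zero hvw haw h ((s ^ m)⁻¹ * k) h))).exists
  rw [← hr] at hn1 hn2 hn3 hn4
  have e1 := crossing_mul (s ^ m) (r ^ n) (k * raagGen Γ v * k⁻¹)
  have e2 := crossing_mul (r ^ n) (s ^ m) (k * raagGen Γ v * k⁻¹)
  rw [hs, crossing_conj_pow hvu, ← hs, hm1, conjk (s ^ m), hr, crossing_conj_pow hvw, ← hr,
    hn4, ← conjk, hm2] at e1
  rw [hr, crossing_conj_pow hvw, ← hr, hn2, conjk (r ^ n), hs, crossing_conj_pow hvu, ← hs,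
    ← conjk, hn1,
    show (s ^ m)⁻¹ * ((r ^ n)⁻¹ * (k * raagGen Γ v * k⁻¹) * r ^ n) * s ^ m =
      (r ^ n * s ^ m)⁻¹ * (k * raagGen Γ v * k⁻¹) * (r ^ n * s ^ m) by group, ← hcm,
    show (s ^ m * r ^ n)⁻¹ * (k * raagGen Γ v * k⁻¹) * (s ^ m * r ^ n) =
      (r ^ n)⁻¹ * ((s ^ m)⁻¹ * k * raagGen Γ v * ((s ^ m)⁻¹ * k)⁻¹) * r ^ n by group, hn3] at e2
  linarith

/-- If the base point lies between two walls that do not meet, no element is separated from it by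
both. -/
theorem crossing_eq_zero_or {v w : V} (hvw : v ≠ w) (hadj : ¬ Γ.Adj v w) {g k : RAAG Γ}
    (h1 : crossing g (k * raagGen Γ v * k⁻¹) = 0) (h2 : crossing k (g * raagGen Γ w * g⁻¹) = 0)
    (h : RAAG Γ) :
    crossing h (k * raagGen Γ v * k⁻¹) = 0 ∨ crossing h (g * raagGen Γ w * g⁻¹) = 0 := by
  classical
  obtain ⟨L, rfl⟩ := exists_word h
  induction L using List.reverseRecOn with
  | nil => simp
  | append_singleton L p ih =>
    rw [wordProd_append]
    simp only [wordProd_cons, wordProd_nil, mul_one]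
    set q := wordProd Γ L
    rw [crossing_mul, crossing_mul, crossing_letter, crossing_letter]
    have key : ∀ t, q⁻¹ * t * q = raagGen Γ p.1 → t = q * raagGen Γ p.1 * q⁻¹ := by
      intro t e; rw [← e]; group
    by_cases c1 : q⁻¹ * (k * raagGen Γ v * k⁻¹) * q = raagGen Γ p.1
    · have c := key _ c1
      have hp := eq_of_conj c
      right
      rw [if_neg, add_zero]
      · rw [← h2]
        refine crossing_eq_of_commute hvw.symm (fun a => hadj a.symm) hvw.symm
          (fun a => hadj a.symm) (u := v) (w := v) ?_
        rw [show q * raagGen Γ v * q⁻¹ = k * raagGen Γ v * k⁻¹ by rw [c, hp]]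
      · intro c2
        exact hvw (hp.trans (eq_of_conj (key _ c2)).symm)
    · by_cases c2 : q⁻¹ * (g * raagGen Γ w * g⁻¹) * q = raagGen Γ p.1
      · have c := key _ c2
        have hp := eq_of_conj c
        left
        rw [if_neg c1, add_zero, ← h1]
        refine crossing_eq_of_commute hvw hadj hvw hadj (u := w) (w := w) ?_
        rw [show q * raagGen Γ w * q⁻¹ = g * raagGen Γ w * g⁻¹ by rw [c, hp]]
      · simpa [c1, c2] using ih

theorem eq_one_of_crossing_gen_eq_zero {h : RAAG Γ} (hh : ∀ v, crossing h (raagGen Γ v) = 0) :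
    h = 1 := by
  classical
  obtain ⟨L, rfl⟩ := exists_word h
  induction hn : L.length using Nat.strong_induction_on generalizing L with
  | _ n ih =>
    cases L with
    | nil => simp
    | cons p L =>
      obtain ⟨M, hM, e2⟩ := exists_shorter_word_of_crossing_eq_zero (hh p.1)
      simp only [List.length_cons] at hn
      rw [← e2] at hh ⊢
      exact ih M.length (by omega) M hh rfl

/-- If the base point is not separated from the wall of any `φ w` by a wall of a `φ v` disjoint
from it, then `φ` preserves the crossing numbers of the generators. -/
theorem crossing_map_eq (φ : MulAut (RAAG Γ)) (g : V → RAAG Γ)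
    (hφ : ∀ v, φ (raagGen Γ v) = g v * raagGen Γ v * (g v)⁻¹)
    (h0 : ∀ v w, v ≠ w → ¬ Γ.Adj v w → crossing (g w) (φ (raagGen Γ v)) = 0)
    (h : RAAG Γ) (v : V) :
    crossing (φ h) (φ (raagGen Γ v)) = crossing h (raagGen Γ v) := by
  classical
  obtain ⟨L, rfl⟩ := exists_word h
  induction hn : L.length using Nat.strong_induction_on generalizing L v with
  | _ n ih =>
    cases L with
    | nil => simp
    | cons p L =>
      simp only [List.length_cons] at hn
      have hL := fun v => ih L.length (by omega) v L rfl
      have hself : ∀ u, crossing (φ (raagGen Γ u)) (φ (raagGen Γ u)) = 1 := by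
        intro u
        rw [hφ, crossing_conj, crossing_gen, if_pos (by group),
          show (g u * raagGen Γ u * (g u)⁻¹)⁻¹ * (g u * raagGen Γ u * (g u)⁻¹) *
            (g u * raagGen Γ u * (g u)⁻¹) = g u * raagGen Γ u * (g u)⁻¹ by group]
        ring
      have hstep : ∀ u, Γ.Adj u p.1 ∨ u = p.1 →
          crossing (φ (wordProd Γ (p :: L))) (φ (raagGen Γ u)) =
            crossing (wordProd Γ (p :: L)) (raagGen Γ u) := by
        intro u hu
        have hc : raagGen Γ u * raagGen Γ p.1 = raagGen Γ p.1 * raagGen Γ u := by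
          rcases hu with hu | rfl
          · exact gen_comm hu
          · rfl
        have hcl : (letter Γ p)⁻¹ * raagGen Γ u * letter Γ p = raagGen Γ u := by
          rw [mul_assoc, inv_mul_eq_iff_eq_mul]
          unfold letter
          split_ifs
          · exact hc
          · exact (show Commute _ _ from hc).inv_right.eq
        have hcg : crossing (φ (raagGen Γ p.1)) (φ (raagGen Γ u)) =
            crossing (raagGen Γ p.1) (raagGen Γ u) := by
          by_cases hup : u = p.1
          · rw [hup, hself, crossing_gen, if_pos rfl]
          · have hne : ∀ a b : RAAG Γ, a * raagGen Γ u * a⁻¹ ≠ b * raagGen Γ p.1 * b⁻¹ :=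
              fun a b e => hup (eq_of_conj e)
            have hconj : (φ (raagGen Γ p.1))⁻¹ * φ (raagGen Γ u) * φ (raagGen Γ p.1) =
                φ (raagGen Γ u) := by
              rw [mul_assoc, ← map_mul, hc, map_mul, inv_mul_cancel_left]
            rw [crossing_gen, if_neg (by simpa using hne 1 1), hφ p.1, crossing_conj, ← hφ p.1,
              hconj, crossing_gen, if_neg]
            · ring
            · rw [hφ u]
              intro e
              refine hne ((g p.1)⁻¹ * g u) 1 ?_
              simpa [mul_assoc] using e
        have hcl' : crossing (φ (letter Γ p)) (φ (raagGen Γ u)) =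
            crossing (letter Γ p) (raagGen Γ u) := by
          unfold letter
          split_ifs
          · exact hcg
          · rw [map_inv, crossing_inv, crossing_inv, ← map_inv, ← map_mul, ← map_mul, ← hc,
              mul_inv_cancel_right, hcg]
        rw [wordProd_cons, map_mul, crossing_mul, crossing_mul, ← map_inv, ← map_mul, ← map_mul,
          hcl, hcl', hL]
      by_cases hv : Γ.Adj v p.1 ∨ v = p.1
      · exact hstep v hv
      · rw [not_or] at hv
        by_cases hz : crossing (wordProd Γ (p :: L)) (raagGen Γ p.1) = 0
        · obtain ⟨M, hM, e2⟩ := exists_shorter_word_of_crossing_eq_zero hz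
          rw [← e2]
          exact ih M.length (by omega) v M rfl
        · have a1 := crossing_eq_zero_or (g := 1) (k := 1) hv.2 hv.1 (by simp) (by simp)
            (wordProd Γ (p :: L))
          have a2 := crossing_eq_zero_or (g := g p.1) (k := g v) hv.2 hv.1
            (by rw [← hφ]; exact h0 _ _ hv.2 hv.1)
            (by rw [← hφ]; exact h0 _ _ (Ne.symm hv.2) (fun a => hv.1 a.symm))
            (φ (wordProd Γ (p :: L)))
          rw [← hφ, ← hφ, hstep p.1 (Or.inr rfl)] at a2
          simp only [one_mul, inv_one, mul_one] at a1
          rw [a1.resolve_right hz, a2.resolve_right hz]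

theorem eq_one_of_crossing_eq_zero (φ : MulAut (RAAG Γ)) (g : V → RAAG Γ)
    (hφ : ∀ v, φ (raagGen Γ v) = g v * raagGen Γ v * (g v)⁻¹)
    (h0 : ∀ v w, v ≠ w → ¬ Γ.Adj v w → crossing (g w) (φ (raagGen Γ v)) = 0) : φ = 1 := by
  classical
  have key : ∀ u, φ (raagGen Γ u) = raagGen Γ u := by
    intro u
    by_contra hne
    obtain ⟨h, hh⟩ := φ.surjective (raagGen Γ u)
    have hz : ∀ v, crossing h (raagGen Γ v) = 0 := by
      intro v
      rw [← crossing_map_eq φ g hφ h0, hh, crossing_gen, if_neg]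
      intro e
      have : v = u := eq_of_conj (g := g v) (h := 1) (by rw [← hφ, e]; simp)
      exact hne (this ▸ e)
    have h1 := eq_one_of_crossing_gen_eq_zero hz
    rw [h1, map_one] at hh
    have := crossing_gen u (raagGen Γ u)
    rw [← hh] at this
    simp at this
  have : φ.toMonoidHom = MonoidHom.id _ := hom_ext key
  ext x
  exact DFunLike.congr_fun this x

open Classical in
/-- The endomorphism conjugating by `z` the generators in `K`. -/
noncomputable def partialConjHom (a : V) (K : Set V)
    (hK : ∀ u ∈ K, ∀ w ∉ K, Γ.Adj u w → w ∈ Gstar Γ a) (z : RAAG Γ)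
    (hz : ∀ w ∈ Gstar Γ a, z * raagGen Γ w = raagGen Γ w * z) : RAAG Γ →* RAAG Γ :=
  lift (fun u => if u ∈ K then z⁻¹ * raagGen Γ u * z else raagGen Γ u) (by
    have mixed : ∀ u ∈ K, ∀ w ∉ K, Γ.Adj u w →
        Commute (z⁻¹ * raagGen Γ u * z) (raagGen Γ w) := by
      intro u hu w hw huw
      have h1 : Commute z (raagGen Γ w) := hz w (hK u hu w hw huw)
      exact (h1.inv_left.mul_left (gen_comm huw)).mul_left h1
    intro u w huw
    by_cases hu : u ∈ K <;> by_cases hw : w ∈ K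
    · simp only [hu, hw, if_true]
      rw [show z⁻¹ * raagGen Γ u * z * (z⁻¹ * raagGen Γ w * z) =
        z⁻¹ * (raagGen Γ u * raagGen Γ w) * z by group, gen_comm huw]
      group
    · simpa [hu, hw] using (mixed u hu w hw huw).eq
    · simpa [hu, hw] using (mixed w hw u hu huw.symm).symm.eq
    · simpa [hu, hw] using gen_comm huw)

theorem exists_isPartialConj {a : V} {K : Set V} (hK : IsCompOf Γ (Gstar Γ a)ᶜ K) :
    ∃ π : MulAut (RAAG Γ), IsPartialConj Γ a K π := by
  classical
  have hcompl : ∀ u ∈ K, u ∉ Gstar Γ a := by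
    obtain ⟨c, rfl⟩ := hK
    rintro _ ⟨x, -, rfl⟩
    exact x.2
  have hbd : ∀ u ∈ K, ∀ w ∉ K, Γ.Adj u w → w ∈ Gstar Γ a := by
    obtain ⟨c, rfl⟩ := hK
    rintro _ ⟨x, hx, rfl⟩ w hw huw
    by_contra hwa
    refine hw ⟨⟨w, hwa⟩, ?_, rfl⟩
    have hadj : (Γ.induce (Gstar Γ a)ᶜ).Adj x ⟨w, hwa⟩ := huw
    rw [SimpleGraph.ConnectedComponent.mem_supp_iff] at hx ⊢
    rw [← hx]
    exact (SimpleGraph.ConnectedComponent.sound hadj.reachable).symm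
  have haK : a ∉ K := fun h => hcompl a h (Set.mem_insert _ _)
  have hz : ∀ w ∈ Gstar Γ a, Commute (raagGen Γ a) (raagGen Γ w) := by
    rintro w (rfl | hw)
    · exact Commute.refl _
    · exact gen_comm hw
  let f := partialConjHom a K hbd (raagGen Γ a) hz
  let f' := partialConjHom a K hbd (raagGen Γ a)⁻¹ (fun w hw => (hz w hw).inv_left)
  have hf : ∀ u, f (raagGen Γ u) = if u ∈ K then (raagGen Γ a)⁻¹ * raagGen Γ u * raagGen Γ a
      else raagGen Γ u := fun u => lift_gen _ _ u
  have hf' : ∀ u, f' (raagGen Γ u) = if u ∈ K then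
      (raagGen Γ a)⁻¹⁻¹ * raagGen Γ u * (raagGen Γ a)⁻¹
      else raagGen Γ u := fun u => lift_gen _ _ u
  have h1 : f'.comp f = MonoidHom.id _ := hom_ext fun u => by
    by_cases hu : u ∈ K <;> simp [hf, hf', hu, haK, mul_assoc]
  have h2 : f.comp f' = MonoidHom.id _ := hom_ext fun u => by
    by_cases hu : u ∈ K <;> simp [hf, hf', hu, haK, mul_assoc]
  refine ⟨MonoidHom.toMulEquiv f f' h1 h2, hK, fun v hv => ?_, fun v hv => ?_⟩
  · simpa [hv] using hf v
  · simpa [hv] using hf v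

theorem mem_closure_of_words [Fintype V] (φ : MulAut (RAAG Γ)) (L : V → List (V × Bool))
    (hφ : ∀ v, φ (raagGen Γ v) = wordProd Γ (L v) * raagGen Γ v * (wordProd Γ (L v))⁻¹) :
    φ ∈ Subgroup.closure
      {φ : MulAut (RAAG Γ) | ∃ (a : V) (K : Set V), IsPartialConj Γ a K φ} := by
  classical
  induction hn : ∑ v, (L v).length using Nat.strong_induction_on generalizing φ L with
  | _ n ih =>
    by_cases h0 : ∀ v w, v ≠ w → ¬ Γ.Adj v w →
        crossing (wordProd Γ (L w)) (φ (raagGen Γ v)) = 0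
    · rw [eq_one_of_crossing_eq_zero φ (fun v => wordProd Γ (L v)) hφ h0]
      exact one_mem _
    push Not at h0
    obtain ⟨v, w, hvw, hadj, hne⟩ := h0
    have hstar : ∀ u, u ∈ (Gstar Γ v)ᶜ ↔ v ≠ u ∧ ¬ Γ.Adj v u := by
      intro u
      simp [Gstar, eq_comm]
    have hw : w ∈ (Gstar Γ v)ᶜ := (hstar w).2 ⟨hvw, hadj⟩
    let c := (Γ.induce (Gstar Γ v)ᶜ).connectedComponentMk ⟨w, hw⟩
    have hK : IsCompOf Γ (Gstar Γ v)ᶜ (Subtype.val '' c.supp) := ⟨c, rfl⟩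
    set K := Subtype.val '' c.supp with hKdef
    have hwK : w ∈ K := ⟨⟨w, hw⟩, rfl, rfl⟩
    have hconst : ∀ u ∈ K, crossing (wordProd Γ (L u)) (φ (raagGen Γ v)) =
        crossing (wordProd Γ (L w)) (φ (raagGen Γ v)) := by
      rintro _ ⟨x, hx, rfl⟩
      have hr : (Γ.induce (Gstar Γ v)ᶜ).Reachable x ⟨w, hw⟩ :=
        SimpleGraph.ConnectedComponent.exact hx
      obtain ⟨p⟩ := hr
      clear hx
      generalize hy : (⟨w, hw⟩ : ↥(Gstar Γ v)ᶜ) = y at p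
      have hyw : w = y.1 := by rw [← hy]
      rw [hyw]
      clear hy hyw
      induction p with
      | nil => rfl
      | @cons x y z hxy _ ih' =>
        rw [← ih']
        have hx := (hstar _).1 x.2
        have hy := (hstar _).1 y.2
        have hxy' : Γ.Adj x.1 y.1 := hxy
        rw [hφ v]
        refine crossing_eq_of_commute hx.1 hx.2 hy.1 hy.2 ?_
        rw [← hφ, ← hφ, ← map_mul, gen_comm hxy', map_mul]
    obtain ⟨π, -, hπ1, hπ2⟩ := exists_isPartialConj hK
    have hπmem : π ∈ Subgroup.closure
        {φ : MulAut (RAAG Γ) | ∃ (a : V) (K : Set V), IsPartialConj Γ a K φ} :=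
      Subgroup.subset_closure ⟨v, K, hK, hπ1, hπ2⟩
    have hvK : v ∉ K := by
      rintro ⟨x, -, hx⟩
      exact ((hstar _).1 x.2).1 hx.symm
    obtain ⟨b, hb⟩ : ∃ b : Bool, 0 < (if b then crossing (wordProd Γ (L w)) (φ (raagGen Γ v))
        else -crossing (wordProd Γ (L w)) (φ (raagGen Γ v))) := by
      rcases lt_or_gt_of_ne hne with h | h
      · exact ⟨false, by simpa using h⟩
      · exact ⟨true, by simpa using h⟩
    have hM : ∀ u, ∃ M : List (V × Bool), u ∈ K → M.length < (L u).length ∧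
        wordProd Γ M = (if b then (φ (raagGen Γ v))⁻¹ else φ (raagGen Γ v)) *
          wordProd Γ (L u) := by
      intro u
      by_cases hu : u ∈ K
      · obtain ⟨M, hM⟩ := exists_shorter_word b (L u) (φ (raagGen Γ v)) (by rwa [hconst u hu])
        exact ⟨M, fun _ => hM⟩
      · exact ⟨[], fun h => absurd h hu⟩
    choose M hM using hM
    let ψ : MulAut (RAAG Γ) := if b then π else π⁻¹
    have hψmem : ψ ∈ Subgroup.closure
        {φ : MulAut (RAAG Γ) | ∃ (a : V) (K : Set V), IsPartialConj Γ a K φ} := by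
      simp only [ψ]
      split_ifs
      · exact hπmem
      · exact inv_mem hπmem
    have hψ1 : ∀ u ∈ K, ψ (raagGen Γ u) = (if b then (raagGen Γ v)⁻¹ else raagGen Γ v) *
        raagGen Γ u * (if b then (raagGen Γ v)⁻¹ else raagGen Γ v)⁻¹ := by
      intro u hu
      cases b
      · simp only [ψ, Bool.false_eq_true, if_false, MulAut.inv_def]
        rw [MulEquiv.symm_apply_eq, map_mul, map_mul, map_inv, hπ1 u hu, hπ2 v hvK]
        group
      · simp [ψ, hπ1 u hu]
    have hψ2 : ∀ u ∉ K, ψ (raagGen Γ u) = raagGen Γ u := by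
      intro u hu
      cases b
      · simp only [ψ, Bool.false_eq_true, if_false, MulAut.inv_def]
        rw [MulEquiv.symm_apply_eq, hπ2 u hu]
      · simp [ψ, hπ2 u hu]
    have hlt : ∑ u, (if u ∈ K then M u else L u).length < n := by
      rw [← hn]
      refine Finset.sum_lt_sum (fun u _ => ?_) ⟨w, Finset.mem_univ _, ?_⟩
      · split_ifs with hu
        · exact (hM u hu).1.le
        · exact le_rfl
      · rw [if_pos hwK]
        exact (hM w hwK).1
    have := ih _ hlt (φ * ψ) (fun u => if u ∈ K then M u else L u) (fun u => by
      rw [MulAut.mul_apply]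
      by_cases hu : u ∈ K
      · simp only [hu, if_true]
        rw [hψ1 u hu, (hM u hu).2]
        cases b
        · simp only [Bool.false_eq_true, if_false, map_mul, map_inv]
          rw [hφ u]; group
        · simp only [if_true, map_mul, map_inv]
          rw [hφ u]; group
      · simp only [hu, if_false]
        rw [hψ2 u hu, hφ u]) rfl
    simpa using mul_mem this (inv_mem hψmem)

end RAAG

/-- Laurence's theorem. `PΣ(A)` is generated by the partial
conjugations. -/
theorem psa_generated_by_pc {V : Type} [Fintype V] (Γ : SimpleGraph V) :
    PSA Γ = Subgroup.closure
      {φ : MulAut (RAAG Γ) | ∃ (a : V) (K : Set V), IsPartialConj Γ a K φ} := by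
  apply le_antisymm
  · intro φ hφ
    have h : ∀ v, ∃ L, φ (raagGen Γ v) =
        RAAG.wordProd Γ L * raagGen Γ v * (RAAG.wordProd Γ L)⁻¹ := by
      intro v
      obtain ⟨g, hg⟩ := isConj_iff.1 (hφ v)
      obtain ⟨L, rfl⟩ := RAAG.exists_word g
      exact ⟨L, hg.symm⟩
    choose L hL using h
    exact RAAG.mem_closure_of_words φ L hL
  · rw [Subgroup.closure_le]
    rintro φ ⟨a, K, -, h1, h2⟩ v
    by_cases hv : v ∈ K
    · rw [h1 v hv]
      exact isConj_iff.2 ⟨(raagGen Γ a)⁻¹, by rw [inv_inv]⟩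
    · rw [h2 v hv]
end
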